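/- (Weighted Hardy–Sobolev inequality for the Grushin gradient.) Let p, s, α be real numbers with 1 < p < Q, 0 ≤ s ≤ p, and α > (p−Q)/p, and set p_*(s,p,Q) = p(Q−s)/(Q−p). Then there exists a constant C > 0, depending only on s, p, α, μ and Q, such that for every u ∈ C_0^∞(ℝ^{d+k}): ∫_{ℝ^{d+k}} (|x|^{μs}/ρ^{μs}) · |ρ^α u|^{p_*(s,p,Q)} / ρ^s dx dy ≤ C (∫_{ℝ^{d+k}} |ρ^α ∇_μ u|^p dx dy)^{(Q−s)/(Q−p)}. -/

import Mathlib

open MeasureTheory Real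
open scoped RealInnerProductSpace ENNReal

/-- The anisotropic distance function `ρ(x,y) = (|x|^{2+2μ} + (1+μ)²|y|²)^{1/(2+2μ)}`. -/
noncomputable def grho (μ : ℝ) {d k : ℕ}
    (z : EuclideanSpace ℝ (Fin d) × EuclideanSpace ℝ (Fin k)) : ℝ :=
  (‖z.1‖ ^ (2 + 2 * μ) + (1 + μ) ^ 2 * ‖z.2‖ ^ 2) ^ (1 / (2 + 2 * μ))

/-- The Grushin gradient `∇_μ u = (∇_x u, |x|^μ ∇_y u)`. -/
noncomputable def gradMu (μ : ℝ) {d k : ℕ}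
    (u : EuclideanSpace ℝ (Fin d) × EuclideanSpace ℝ (Fin k) → ℝ)
    (z : EuclideanSpace ℝ (Fin d) × EuclideanSpace ℝ (Fin k)) :
    EuclideanSpace ℝ (Fin d) × EuclideanSpace ℝ (Fin k) :=
  (gradient (fun x => u (x, z.2)) z.1, (‖z.1‖ ^ μ) • gradient (fun y => u (z.1, y)) z.2)

/-- The Euclidean-type norm `((|v₁|² + |v₂|²))^{1/2}` of a pair. -/
noncomputable def pairNorm {d k : ℕ}
    (v : EuclideanSpace ℝ (Fin d) × EuclideanSpace ℝ (Fin k)) : ℝ :=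
  Real.sqrt (‖v.1‖ ^ 2 + ‖v.2‖ ^ 2)

/-- `|∇_μ u| = (|∇_x u|² + |x|^{2μ}|∇_y u|²)^{1/2}`. -/
noncomputable def gradMuNorm (μ : ℝ) {d k : ℕ}
    (u : EuclideanSpace ℝ (Fin d) × EuclideanSpace ℝ (Fin k) → ℝ)
    (z : EuclideanSpace ℝ (Fin d) × EuclideanSpace ℝ (Fin k)) : ℝ :=
  pairNorm (gradMu μ u z)

open Filter Topology Set
open scoped NNReal

/-- The ambient space `ℝ^d × ℝ^k`. -/
abbrev GrushinSpace (d k : ℕ) := EuclideanSpace ℝ (Fin d) × EuclideanSpace ℝ (Fin k)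

/-- The anisotropic dilation `(x, y) ↦ (r x, r^{1+μ} y)`. -/
noncomputable def dilation (μ : ℝ) {d k : ℕ} (r : ℝ) (z : GrushinSpace d k) : GrushinSpace d k :=
  (r • z.1, r ^ (1 + μ) • z.2)

theorem lintegral_comp_smul_addHaar {E : Type*} [NormedAddCommGroup E] [NormedSpace ℝ E]
    [FiniteDimensional ℝ E] [MeasurableSpace E] [BorelSpace E] (ν : Measure E) [ν.IsAddHaarMeasure]
    (f : E → ℝ≥0∞) {r : ℝ} (hr : 0 < r) :
    ∫⁻ x, f (r • x) ∂ν = ENNReal.ofReal (r ^ (-(Module.finrank ℝ E : ℝ))) * ∫⁻ x, f x ∂ν := by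
  rw [← (measurableEmbedding_const_smul₀ hr.ne').lintegral_map f,
    Measure.map_addHaar_smul ν hr.ne', lintegral_smul_measure, abs_of_nonneg (by positivity),
    Real.rpow_neg hr.le, Real.rpow_natCast, smul_eq_mul]

theorem lintegral_comp_dilation {d k : ℕ} (μ : ℝ) {f : GrushinSpace d k → ℝ≥0∞}
    (hf : Measurable f) {r : ℝ} (hr : 0 < r) :
    ∫⁻ z, f (dilation μ r z) = ENNReal.ofReal (r ^ (-(d + (1 + μ) * k))) * ∫⁻ z, f z := by
  have hd : Measurable (dilation μ r : GrushinSpace d k → _) := by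
    unfold dilation; fun_prop
  rw [Measure.volume_eq_prod, lintegral_prod (fun z => f (dilation μ r z)) (hf.comp hd).aemeasurable,
    lintegral_prod _ hf.aemeasurable]
  simp only [dilation]
  have h1 : ∀ x : EuclideanSpace ℝ (Fin d), ∫⁻ y : EuclideanSpace ℝ (Fin k),
      f (r • x, r ^ (1 + μ) • y) =
      ENNReal.ofReal ((r ^ (1 + μ)) ^ (-(k : ℝ))) * ∫⁻ y, f (r • x, y) := fun x => by
    simpa using lintegral_comp_smul_addHaar volume (fun y => f (r • x, y))
      (Real.rpow_pos_of_pos hr (1 + μ))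
  simp only [h1]
  have hm : Measurable fun x : EuclideanSpace ℝ (Fin d) => ∫⁻ y, f (x, y) :=
    hf.lintegral_prod_right'
  rw [lintegral_const_mul' _ _ ENNReal.ofReal_ne_top,
    lintegral_comp_smul_addHaar volume (fun x => ∫⁻ y, f (x, y)) hr, ← mul_assoc,
    ← ENNReal.ofReal_mul (by positivity), ← Real.rpow_mul hr.le, ← Real.rpow_add hr]
  simp only [finrank_euclideanSpace, Fintype.card_fin]
  congr 3
  ring

/-- A function on a half-line that vanishes at infinity is bounded by the integral of its
derivative. -/
theorem enorm_le_lintegral_deriv_of_eventually_zero {f f' : ℝ → ℝ} {a : ℝ}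
    (hcont : ContinuousWithinAt f (Ici a) a) (hderiv : ∀ x ∈ Ioi a, HasDerivAt f (f' x) x)
    (hf' : Measurable f') (hzero : ∀ᶠ x in atTop, f x = 0) :
    ‖f a‖ₑ ≤ ∫⁻ x in Ioi a, ‖f' x‖ₑ := by
  by_cases hfin : ∫⁻ x in Ioi a, ‖f' x‖ₑ = ∞
  · simp [hfin]
  have hint : IntegrableOn f' (Ioi a) :=
    ⟨hf'.aestronglyMeasurable, lt_top_iff_ne_top.2 hfin⟩
  have h := integral_Ioi_of_hasDerivAt_of_tendsto hcont hderiv hint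
    (tendsto_const_nhds.congr' (hzero.mono fun x hx => hx.symm))
  calc ‖f a‖ₑ = ‖∫ x in Ioi a, f' x‖ₑ := by rw [h]; simp
    _ ≤ _ := enorm_integral_le_lintegral_enorm _

/-- The `ℓ¹` variant `|∇_x u| + |x|^μ |∇_y u|` of the length of the Grushin gradient. -/
noncomputable def gradMuSum (μ : ℝ) {d k : ℕ} (u : GrushinSpace d k → ℝ) (z : GrushinSpace d k) :
    ℝ :=
  ‖(fderiv ℝ u z).comp (.inl ℝ _ _)‖ + ‖z.1‖ ^ μ * ‖(fderiv ℝ u z).comp (.inr ℝ _ _)‖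

section gradMuSum

variable {d k : ℕ} {μ : ℝ} {u v : GrushinSpace d k → ℝ} {z : GrushinSpace d k}

theorem gradMuSum_nonneg : 0 ≤ gradMuSum μ u z := by
  unfold gradMuSum; positivity

theorem fderiv_pair_apply (a : EuclideanSpace ℝ (Fin d)) (b : EuclideanSpace ℝ (Fin k)) :
    fderiv ℝ u z (a, b) =
      (fderiv ℝ u z).comp (.inl ℝ _ _) a + (fderiv ℝ u z).comp (.inr ℝ _ _) b := by
  simp [← map_add]

theorem abs_fderiv_pair_le {B : ℝ} {a : EuclideanSpace ℝ (Fin d)}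
    {b : EuclideanSpace ℝ (Fin k)} (hb : ‖b‖ ≤ B * ‖z.1‖ ^ μ) (hB : 0 ≤ B) :
    |fderiv ℝ u z (a, b)| ≤ (‖a‖ + B) * gradMuSum μ u z := by
  rw [fderiv_pair_apply, gradMuSum]
  set L := (fderiv ℝ u z).comp (.inl ℝ (EuclideanSpace ℝ (Fin d)) (EuclideanSpace ℝ (Fin k)))
  set M := (fderiv ℝ u z).comp (.inr ℝ (EuclideanSpace ℝ (Fin d)) (EuclideanSpace ℝ (Fin k)))
  have h1 : |L a| ≤ ‖L‖ * ‖a‖ := L.le_opNorm a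
  have h2 : |M b| ≤ ‖M‖ * (B * ‖z.1‖ ^ μ) := (M.le_opNorm b).trans (by gcongr)
  have h3 : 0 ≤ ‖a‖ * (‖z.1‖ ^ μ * ‖M‖) := by positivity
  have h4 : 0 ≤ B * ‖L‖ := by positivity
  calc |L a + M b| ≤ |L a| + |M b| := abs_add_le _ _
    _ ≤ _ := by nlinarith

theorem gradMu_norms (hu : DifferentiableAt ℝ u z) :
    ‖(gradMu μ u z).1‖ = ‖(fderiv ℝ u z).comp (.inl ℝ _ _)‖ ∧
    ‖(gradMu μ u z).2‖ = ‖z.1‖ ^ μ * ‖(fderiv ℝ u z).comp (.inr ℝ _ _)‖ := by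
  obtain ⟨x, y⟩ := z
  have h1 : HasFDerivAt (fun x' => u (x', y)) ((fderiv ℝ u (x, y)).comp (.inl ℝ _ _)) x :=
    HasFDerivAt.comp x (f := fun x' => (x', y)) hu.hasFDerivAt (hasFDerivAt_prodMk_left x y)
  have h2 : HasFDerivAt (fun y' => u (x, y')) ((fderiv ℝ u (x, y)).comp (.inr ℝ _ _)) y :=
    HasFDerivAt.comp y (f := fun y' => (x, y')) hu.hasFDerivAt (hasFDerivAt_prodMk_right x y)
  constructor
  · simp only [gradMu, gradient, h1.fderiv, LinearIsometryEquiv.norm_map]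
  · simp only [gradMu, gradient, h2.fderiv, norm_smul, LinearIsometryEquiv.norm_map]
    rw [Real.norm_of_nonneg (by positivity)]

theorem gradMuSum_le (hu : DifferentiableAt ℝ u z) :
    gradMuSum μ u z ≤ 2 * gradMuNorm μ u z := by
  obtain ⟨h1, h2⟩ := gradMu_norms (μ := μ) hu
  rw [gradMuSum, ← h1, ← h2, gradMuNorm, pairNorm]
  have ha : ‖(gradMu μ u z).1‖ ≤ √(‖(gradMu μ u z).1‖ ^ 2 + ‖(gradMu μ u z).2‖ ^ 2) :=
    Real.le_sqrt_of_sq_le (by nlinarith [sq_nonneg ‖(gradMu μ u z).2‖])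
  have hb : ‖(gradMu μ u z).2‖ ≤ √(‖(gradMu μ u z).1‖ ^ 2 + ‖(gradMu μ u z).2‖ ^ 2) :=
    Real.le_sqrt_of_sq_le (by nlinarith [sq_nonneg ‖(gradMu μ u z).1‖])
  linarith

theorem gradMuNorm_nonneg : 0 ≤ gradMuNorm μ u z := Real.sqrt_nonneg _

theorem gradMuNorm_eq (hu : DifferentiableAt ℝ u z) :
    gradMuNorm μ u z = √(‖(fderiv ℝ u z).comp (.inl ℝ _ _)‖ ^ 2 +
      (‖z.1‖ ^ μ * ‖(fderiv ℝ u z).comp (.inr ℝ _ _)‖) ^ 2) := by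
  obtain ⟨h1, h2⟩ := gradMu_norms (μ := μ) hu
  rw [gradMuNorm, pairNorm, h1, h2]

theorem continuous_gradMuNorm (hμ : 0 < μ) (hu : ContDiff ℝ 1 u) :
    Continuous (gradMuNorm μ u) := by
  have h : Continuous fun z => fderiv ℝ u z := hu.continuous_fderiv one_ne_zero
  have : gradMuNorm μ u = fun z => √(‖(fderiv ℝ u z).comp (.inl ℝ _ _)‖ ^ 2 +
      (‖z.1‖ ^ μ * ‖(fderiv ℝ u z).comp (.inr ℝ _ _)‖) ^ 2) :=
    funext fun z => gradMuNorm_eq (hu.differentiable one_ne_zero z)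
  rw [this]
  have h3 : Continuous fun z : GrushinSpace d k => ‖z.1‖ ^ μ :=
    (continuous_fst.norm).rpow_const fun _ => Or.inr hμ.le
  fun_prop

theorem continuous_gradMuSum (hμ : 0 < μ) (hu : ContDiff ℝ 1 u) : Continuous (gradMuSum μ u) := by
  have h : Continuous fun z => fderiv ℝ u z := hu.continuous_fderiv one_ne_zero
  unfold gradMuSum
  have h3 : Continuous fun z : GrushinSpace d k => ‖z.1‖ ^ μ :=
    (continuous_fst.norm).rpow_const fun _ => Or.inr hμ.le
  fun_prop

theorem gradMuSum_mul_le (hu : DifferentiableAt ℝ u z) (hv : DifferentiableAt ℝ v z) :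
    gradMuSum μ (fun w => u w * v w) z ≤ |u z| * gradMuSum μ v z + |v z| * gradMuSum μ u z := by
  have key : ∀ {E : Type} [NormedAddCommGroup E] [NormedSpace ℝ E]
      (i : E →L[ℝ] GrushinSpace d k), ‖(fderiv ℝ (fun w => u w * v w) z).comp i‖ ≤
      |u z| * ‖(fderiv ℝ v z).comp i‖ + |v z| * ‖(fderiv ℝ u z).comp i‖ := fun i => by
    rw [fderiv_fun_mul hu hv, ContinuousLinearMap.add_comp, ContinuousLinearMap.smul_comp,
      ContinuousLinearMap.smul_comp]
    refine (norm_add_le _ _).trans_eq ?_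
    simp [norm_smul]
  have h1 := key (.inl ℝ (EuclideanSpace ℝ (Fin d)) (EuclideanSpace ℝ (Fin k)))
  have h2 := mul_le_mul_of_nonneg_left
    (key (.inr ℝ (EuclideanSpace ℝ (Fin d)) (EuclideanSpace ℝ (Fin k))))
    (show 0 ≤ ‖z.1‖ ^ μ by positivity)
  unfold gradMuSum
  linarith

theorem gradMuSum_comp {φ : ℝ → ℝ} (hφ : DifferentiableAt ℝ φ (u z))
    (hu : DifferentiableAt ℝ u z) :
    gradMuSum μ (fun w => φ (u w)) z = |deriv φ (u z)| * gradMuSum μ u z := by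
  have : fderiv ℝ (fun w => φ (u w)) z = deriv φ (u z) • fderiv ℝ u z :=
    (hφ.hasDerivAt.comp_hasFDerivAt z hu.hasFDerivAt).fderiv
  simp only [gradMuSum, this, ContinuousLinearMap.smul_comp, norm_smul, Real.norm_eq_abs]
  ring

end gradMuSum

/-- The derivative of `u` along the generator of the anisotropic dilations. -/
noncomputable def eulerDeriv (μ : ℝ) {d k : ℕ} (u : GrushinSpace d k → ℝ) (z : GrushinSpace d k) :
    ℝ :=
  fderiv ℝ u z (z.1, (1 + μ) • z.2)

theorem HasCompactSupport.eventually_comp_eq_zero {E : Type*} [NormedAddCommGroup E]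
    [ProperSpace E] {u : E → ℝ} (hu : HasCompactSupport u) {γ : ℝ → E}
    (hγ : Tendsto (fun t => ‖γ t‖) atTop atTop) : ∀ᶠ t in atTop, u (γ t) = 0 := by
  have h : u =ᶠ[Filter.cocompact E] 0 := by
    rw [← Filter.coclosedCompact_eq_cocompact]
    exact hasCompactSupport_iff_eventuallyEq.1 hu
  rw [← Metric.cobounded_eq_cocompact] at h
  exact (tendsto_norm_atTop_iff_cobounded.1 hγ).eventually h

theorem lintegral_exp_neg_mul_ne_top {c : ℝ} (hc : 0 < c) :
    ∫⁻ t in Ioi (0 : ℝ), ENNReal.ofReal (exp (-c * t)) ≠ ∞ :=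
  (exp_neg_integrableOn_Ioi 0 hc).lintegral_lt_top.ne

theorem exists_rpow_lintegral_Ioi_le {p c : ℝ} (hp : 1 < p) (hc : 0 < c) :
    ∃ K : ℝ≥0∞, K ≠ ∞ ∧ ∀ a : ℝ → ℝ≥0∞, Measurable a →
      (∫⁻ t in Ioi (0 : ℝ), a t) ^ p ≤
        K * ∫⁻ t in Ioi (0 : ℝ), ENNReal.ofReal (exp (c * t)) * a t ^ p := by
  have hp0 : 0 < p := by linarith
  set ε := c / p with hε
  have hε0 : 0 < ε := by positivity
  have hεp : ε * p = c := by rw [hε]; field_simp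
  set q := p.conjExponent
  have hpq : p.HolderConjugate q := .conjExponent hp
  set K := (∫⁻ t in Ioi (0 : ℝ), ENNReal.ofReal (exp (-ε * t)) ^ q) ^ (1 / q)
  have hKtop : K ≠ ∞ := by
    refine ENNReal.rpow_ne_top_of_nonneg (by have := hpq.symm.pos; positivity) ?_
    have : ∀ t : ℝ, ENNReal.ofReal (exp (-ε * t)) ^ q = ENNReal.ofReal (exp (-(ε * q) * t)) :=
      fun t => by
        rw [ENNReal.ofReal_rpow_of_pos (exp_pos _), ← Real.exp_mul]
        ring_nf
    simp only [this]
    exact lintegral_exp_neg_mul_ne_top (mul_pos hε0 hpq.symm.pos)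
  refine ⟨K ^ p, ENNReal.rpow_ne_top_of_nonneg hp0.le hKtop, fun a ha => ?_⟩
  have h2 : ∫⁻ t in Ioi (0 : ℝ), a t ≤
      K * (∫⁻ t in Ioi (0 : ℝ), (ENNReal.ofReal (exp (ε * t)) * a t) ^ p) ^ (1 / p) := by
    have := ENNReal.lintegral_mul_le_Lp_mul_Lq (volume.restrict (Ioi (0 : ℝ))) hpq.symm
      (f := fun t => ENNReal.ofReal (exp (-ε * t)))
      (g := fun t => ENNReal.ofReal (exp (ε * t)) * a t) (by fun_prop) (by fun_prop)
    refine le_trans (le_of_eq (lintegral_congr fun t => ?_)) this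
    simp only [Pi.mul_apply]
    rw [← mul_assoc, ← ENNReal.ofReal_mul (exp_pos _).le, ← Real.exp_add]
    simp
  refine (ENNReal.rpow_le_rpow h2 hp0.le).trans_eq ?_
  rw [ENNReal.mul_rpow_of_nonneg _ _ hp0.le, ← ENNReal.rpow_mul _ (1 / p) p, one_div,
    inv_mul_cancel₀ hp0.ne', ENNReal.rpow_one]
  congr 1
  refine lintegral_congr fun t => ?_
  rw [ENNReal.mul_rpow_of_nonneg _ _ hp0.le, ENNReal.ofReal_rpow_of_pos (exp_pos _),
    ← Real.exp_mul, ← hεp]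
  ring_nf

section euler

variable {d k : ℕ} {μ : ℝ} {u : GrushinSpace d k → ℝ}

theorem measurable_uncurry_dilation_exp (μ : ℝ) :
    Measurable fun w : GrushinSpace d k × ℝ => dilation μ (exp w.2) w.1 := by
  unfold dilation; fun_prop

theorem continuous_eulerDeriv (hu : ContDiff ℝ 1 u) : Continuous (eulerDeriv μ u) := by
  have h : Continuous fun z => fderiv ℝ u z := hu.continuous_fderiv one_ne_zero
  unfold eulerDeriv
  fun_prop

theorem tendsto_norm_dilation_exp (hμ : 0 < μ) {z : GrushinSpace d k} (hz : z ≠ 0) :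
    Tendsto (fun t => ‖dilation μ (exp t) z‖) atTop atTop := by
  have h1 : Tendsto exp atTop atTop := Real.tendsto_exp_atTop
  by_cases hx : z.1 = 0
  · have hy : z.2 ≠ 0 := fun hy => hz (Prod.ext hx hy)
    refine tendsto_atTop_mono (fun t => norm_snd_le (dilation μ (exp t) z)) ?_
    simp only [dilation, norm_smul]
    refine Tendsto.atTop_mul_const (norm_pos_iff.2 hy) ?_
    refine tendsto_norm_atTop_atTop.comp ?_
    exact (tendsto_rpow_atTop (by linarith)).comp h1
  · refine tendsto_atTop_mono (fun t => norm_fst_le (dilation μ (exp t) z)) ?_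
    simp only [dilation, norm_smul]
    exact Tendsto.atTop_mul_const (norm_pos_iff.2 hx) (tendsto_norm_atTop_atTop.comp h1)

theorem enorm_le_lintegral_eulerDeriv (hμ : 0 < μ) (hu : ContDiff ℝ 1 u)
    (hc : HasCompactSupport u) {z : GrushinSpace d k} (hz : z ≠ 0) :
    ‖u z‖ₑ ≤ ∫⁻ t in Ioi (0 : ℝ), ‖eulerDeriv μ u (dilation μ (exp t) z)‖ₑ := by
  have hderiv : ∀ t : ℝ, HasDerivAt (fun t => u (dilation μ (exp t) z))
      (eulerDeriv μ u (dilation μ (exp t) z)) t := fun t => by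
    have h1 : HasDerivAt (fun t => exp t • z.1) (exp t • z.1) t :=
      (Real.hasDerivAt_exp t).smul_const z.1
    have h2 : HasDerivAt (fun t => exp t ^ (1 + μ) • z.2) ((1 + μ) • exp t ^ (1 + μ) • z.2) t := by
      have : HasDerivAt (fun t => exp t ^ (1 + μ)) ((1 + μ) * exp t ^ (1 + μ)) t := by
        simp only [← Real.exp_mul]
        have h3 := ((hasDerivAt_id t).mul_const (1 + μ)).exp
        simpa [mul_comm] using h3
      rw [smul_smul]
      exact this.smul_const z.2
    exact (hu.differentiable one_ne_zero _).hasFDerivAt.comp_hasDerivAt t (h1.prodMk h2)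
  have h := enorm_le_lintegral_deriv_of_eventually_zero (a := 0)
    (hderiv 0).continuousAt.continuousWithinAt (fun t _ => hderiv t)
    ((continuous_eulerDeriv hu).measurable.comp
      ((measurable_uncurry_dilation_exp μ).comp (measurable_const.prodMk measurable_id)))
    (hc.eventually_comp_eq_zero (tendsto_norm_dilation_exp hμ hz))
  simpa [dilation] using h

theorem ae_ne_zero (hd : 1 ≤ d) : ∀ᵐ z : GrushinSpace d k, z ≠ 0 := by
  have : Nonempty (Fin d) := ⟨⟨0, hd⟩⟩
  have : Nontrivial (EuclideanSpace ℝ (Fin d)) := inferInstance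
  simp only [ae_iff, not_not, ne_eq, Set.ofPred_eq_eq_singleton]
  rw [← Prod.mk_zero_zero, ← singleton_prod_singleton, Measure.volume_eq_prod, Measure.prod_prod]
  simp

/-- Hardy inequality for a homogeneous weight and the derivative along dilations. -/
theorem exists_lintegral_weight_le_eulerDeriv (hd : 1 ≤ d) (hμ : 0 < μ) {p m : ℝ} (hp : 1 < p)
    {W : GrushinSpace d k → ℝ≥0∞} (hW : Measurable W)
    (hWm : ∀ t z, W (dilation μ (exp t) z) = ENNReal.ofReal (exp (m * t)) * W z)
    (hm : 0 < d + (1 + μ) * k + m) :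
    ∃ C : ℝ≥0∞, C ≠ ∞ ∧ ∀ u : GrushinSpace d k → ℝ, ContDiff ℝ 1 u → HasCompactSupport u →
      ∫⁻ z, W z * ‖u z‖ₑ ^ p ≤ C * ∫⁻ z, W z * ‖eulerDeriv μ u z‖ₑ ^ p := by
  set κ := d + (1 + μ) * k + m with hκ
  have hp0 : 0 < p := by linarith
  obtain ⟨K, hK, hKle⟩ := exists_rpow_lintegral_Ioi_le hp (c := κ / 2) (by positivity)
  set J := ∫⁻ t in Ioi (0 : ℝ), ENNReal.ofReal (exp (-(κ / 2) * t)) with hJ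
  have hJtop : J ≠ ∞ := lintegral_exp_neg_mul_ne_top (c := κ / 2) (by positivity)
  refine ⟨K * J, ENNReal.mul_ne_top hK hJtop, fun u hu hc => ?_⟩
  have hZ : Measurable fun z => ‖eulerDeriv μ u z‖ₑ := by
    have h := (continuous_eulerDeriv (μ := μ) hu).measurable
    fun_prop
  have hZd : Measurable fun w : GrushinSpace d k × ℝ =>
      ‖eulerDeriv μ u (dilation μ (exp w.2) w.1)‖ₑ :=
    Measurable.comp (g := fun z => ‖eulerDeriv μ u z‖ₑ) hZ (measurable_uncurry_dilation_exp μ)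
  have hZt : ∀ z : GrushinSpace d k, Measurable fun t : ℝ =>
      ‖eulerDeriv μ u (dilation μ (exp t) z)‖ₑ := fun z =>
    Measurable.comp (f := fun t : ℝ => (z, t)) hZd (by fun_prop)
  have hpt : ∀ z : GrushinSpace d k, z ≠ 0 → ‖u z‖ₑ ^ p ≤ K * ∫⁻ t in Ioi (0 : ℝ),
      ENNReal.ofReal (exp (κ / 2 * t)) * ‖eulerDeriv μ u (dilation μ (exp t) z)‖ₑ ^ p := by
    intro z hz
    have h1 := enorm_le_lintegral_eulerDeriv hμ hu hc hz
    have h2 := hKle _ (hZt z)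
    exact (ENNReal.rpow_le_rpow h1 hp0.le).trans h2
  have hin : ∀ t : ℝ, ∫⁻ z : GrushinSpace d k, W z * (ENNReal.ofReal (exp (κ / 2 * t)) *
      ‖eulerDeriv μ u (dilation μ (exp t) z)‖ₑ ^ p) =
      ENNReal.ofReal (exp (-(κ / 2) * t)) * ∫⁻ z, W z * ‖eulerDeriv μ u z‖ₑ ^ p := by
    intro t
    have h1 : ∀ z : GrushinSpace d k, W z * (ENNReal.ofReal (exp (κ / 2 * t)) *
        ‖eulerDeriv μ u (dilation μ (exp t) z)‖ₑ ^ p) =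
        ENNReal.ofReal (exp ((κ / 2 - m) * t)) * (W (dilation μ (exp t) z) *
        ‖eulerDeriv μ u (dilation μ (exp t) z)‖ₑ ^ p) := fun z => by
      rw [hWm, show exp (κ / 2 * t) = exp ((κ / 2 - m) * t) * exp (m * t) by
        rw [← Real.exp_add]; ring_nf, ENNReal.ofReal_mul (exp_pos _).le]
      ring
    simp only [h1]
    rw [lintegral_const_mul' _ _ ENNReal.ofReal_ne_top,
      lintegral_comp_dilation μ (f := fun z => W z * ‖eulerDeriv μ u z‖ₑ ^ p) (by fun_prop)
      (exp_pos t), ← mul_assoc, ← ENNReal.ofReal_mul (exp_pos _).le, ← Real.exp_mul,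
      ← Real.exp_add]
    congr 3
    rw [hκ]; ring
  calc ∫⁻ z, W z * ‖u z‖ₑ ^ p
      ≤ ∫⁻ z, W z * (K * ∫⁻ t in Ioi (0 : ℝ), ENNReal.ofReal (exp (κ / 2 * t)) *
          ‖eulerDeriv μ u (dilation μ (exp t) z)‖ₑ ^ p) := by
        apply lintegral_mono_ae
        filter_upwards [ae_ne_zero hd] with z hz
        gcongr
        exact hpt z hz
    _ = K * ∫⁻ z, ∫⁻ t in Ioi (0 : ℝ), W z * (ENNReal.ofReal (exp (κ / 2 * t)) *
          ‖eulerDeriv μ u (dilation μ (exp t) z)‖ₑ ^ p) := by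
        rw [← lintegral_const_mul' _ _ hK]
        refine lintegral_congr fun z => ?_
        have hm1 := hZt z
        rw [lintegral_const_mul _ (by fun_prop)]
        ring
    _ = K * ∫⁻ t in Ioi (0 : ℝ), ∫⁻ z, W z * (ENNReal.ofReal (exp (κ / 2 * t)) *
          ‖eulerDeriv μ u (dilation μ (exp t) z)‖ₑ ^ p) := by
        rw [lintegral_lintegral_swap]
        refine Measurable.aemeasurable ?_
        simp only [Function.uncurry_def]
        fun_prop
    _ = K * J * ∫⁻ z, W z * ‖eulerDeriv μ u z‖ₑ ^ p := by
        simp only [hin]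
        rw [lintegral_mul_const _ (by fun_prop), mul_assoc]

end euler

section weakType

variable {d k : ℕ} {μ : ℝ} {u : GrushinSpace d k → ℝ}

theorem le_norm_add_smul {E : Type*} [NormedAddCommGroup E] [InnerProductSpace ℝ E] {x ω : E}
    {r : ℝ} (hr : 0 ≤ r) (hω : 1 ≤ ‖ω‖) (hx : 0 ≤ ⟪x, ω⟫) : r ≤ ‖x + r • ω‖ := by
  refine le_of_sq_le_sq ?_ (norm_nonneg _)
  rw [norm_add_sq_real, inner_smul_right, norm_smul, mul_pow, Real.norm_of_nonneg hr]
  have h1 : r ^ 2 * 1 ≤ r ^ 2 * ‖ω‖ ^ 2 := by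
    gcongr
    exact one_le_pow₀ hω
  have h2 : 0 ≤ r * ⟪x, ω⟫ := by positivity
  nlinarith [sq_nonneg ‖x‖]

theorem enorm_le_lintegral_gradMuSum_of_inner_nonneg (hμ : 0 < μ) (hu : ContDiff ℝ 1 u)
    (hc : HasCompactSupport u) {z θ : GrushinSpace d k} (h1 : 1 ≤ ‖θ.1‖) (h2 : ‖θ.1‖ ≤ 2)
    (h3 : ‖θ.2‖ ≤ 1) (hz : 0 ≤ ⟪z.1, θ.1⟫) :
    ‖u z‖ₑ ≤ ENNReal.ofReal (3 + μ) * ∫⁻ r in Ioi (0 : ℝ),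
      ENNReal.ofReal (gradMuSum μ u (z + dilation μ r θ)) := by
  have hcont : Continuous fun r : ℝ => u (z + dilation μ r θ) := by
    have : Continuous fun r : ℝ => r ^ (1 + μ) := continuous_id.rpow_const fun _ => .inr (by linarith)
    have := hu.continuous
    unfold dilation
    fun_prop
  set f' : ℝ → ℝ := fun r =>
    fderiv ℝ u (z + dilation μ r θ) (θ.1, ((1 + μ) * r ^ μ) • θ.2) with hf'
  have hderiv : ∀ r ∈ Ioi (0 : ℝ), HasDerivAt (fun r : ℝ => u (z + dilation μ r θ)) (f' r) r := by
    intro r hr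
    have e1 : HasDerivAt (fun r : ℝ => r • θ.1) θ.1 r := by
      simpa using (hasDerivAt_id r).smul_const θ.1
    have e2 : HasDerivAt (fun r : ℝ => r ^ (1 + μ) • θ.2) (((1 + μ) * r ^ μ) • θ.2) r := by
      have := (Real.hasDerivAt_rpow_const (p := 1 + μ) (Or.inl (ne_of_gt hr))).smul_const θ.2
      simpa using this
    exact (hu.differentiable one_ne_zero _).hasFDerivAt.comp_hasDerivAt r
      ((e1.prodMk e2).const_add z)
  have hmeas : Measurable f' := by
    have g1 : Continuous fun w : GrushinSpace d k × GrushinSpace d k => fderiv ℝ u w.1 w.2 := by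
      have : Continuous fun z => fderiv ℝ u z := hu.continuous_fderiv one_ne_zero
      fun_prop
    have g2 : Measurable fun r : ℝ =>
        (z + dilation μ r θ, ((θ.1, ((1 + μ) * r ^ μ) • θ.2) : GrushinSpace d k)) := by
      unfold dilation; fun_prop
    exact Measurable.comp (f := fun r : ℝ =>
        (z + dilation μ r θ, ((θ.1, ((1 + μ) * r ^ μ) • θ.2) : GrushinSpace d k)))
      g1.measurable g2
  have htend : Tendsto (fun r : ℝ => ‖z + dilation μ r θ‖) atTop atTop := by
    refine tendsto_atTop_mono' _ ?_ (tendsto_atTop_add_const_right atTop (-‖z.1‖) tendsto_id)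
    filter_upwards [eventually_ge_atTop 0] with r hr
    have e1 : ‖r • θ.1‖ ≤ ‖z.1 + r • θ.1‖ + ‖z.1‖ := by
      simpa using norm_sub_le (z.1 + r • θ.1) z.1
    have e2 : ‖z.1 + r • θ.1‖ ≤ ‖z + dilation μ r θ‖ := norm_fst_le (z + dilation μ r θ)
    have e3 : r * 1 ≤ ‖r • θ.1‖ := by
      rw [norm_smul, Real.norm_of_nonneg hr]
      gcongr
    simp only [id]
    linarith
  have h := enorm_le_lintegral_deriv_of_eventually_zero (a := 0)
    hcont.continuousAt.continuousWithinAt hderiv hmeas (hc.eventually_comp_eq_zero htend)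
  have h0 : dilation μ 0 θ = 0 := by
    simp [dilation, Real.zero_rpow (show 1 + μ ≠ 0 by linarith)]
  rw [h0, add_zero] at h
  refine h.trans ?_
  rw [← lintegral_const_mul' _ _ ENNReal.ofReal_ne_top]
  refine setLIntegral_mono' measurableSet_Ioi fun r hr => ?_
  have hr0 : (0 : ℝ) < r := hr
  rw [← ENNReal.ofReal_mul (by linarith), Real.enorm_eq_ofReal_abs]
  refine ENNReal.ofReal_le_ofReal ?_
  have hb : ‖((1 + μ) * r ^ μ) • θ.2‖ ≤ (1 + μ) * ‖(z + dilation μ r θ).1‖ ^ μ := by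
    rw [norm_smul, Real.norm_of_nonneg (by positivity)]
    have e1 : r ≤ ‖(z + dilation μ r θ).1‖ := le_norm_add_smul hr0.le h1 hz
    have e2 : r ^ μ ≤ ‖(z + dilation μ r θ).1‖ ^ μ := Real.rpow_le_rpow hr0.le e1 hμ.le
    calc (1 + μ) * r ^ μ * ‖θ.2‖ ≤ (1 + μ) * r ^ μ * 1 := by gcongr
      _ ≤ _ := by rw [mul_one]; gcongr
  refine (abs_fderiv_pair_le hb (by linarith)).trans ?_
  exact mul_le_mul_of_nonneg_right (by linarith) gradMuSum_nonneg

/-- The set of directions used to connect a point to infinity. -/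
def directionSet (d k : ℕ) : Set (GrushinSpace d k) :=
  {θ | (1 ≤ ‖θ.1‖ ∧ ‖θ.1‖ ≤ 2) ∧ ‖θ.2‖ ≤ 1}

theorem measurableSet_directionSet : MeasurableSet (directionSet d k) := by
  unfold directionSet
  measurability

theorem volume_directionSet_ne_top : volume (directionSet d k) ≠ ∞ := by
  refine ne_top_of_le_ne_top (measure_closedBall_lt_top (x := (0 : GrushinSpace d k)) (r := 2)).ne
    (measure_mono fun θ hθ => ?_)
  obtain ⟨⟨h1, h2⟩, h3⟩ := hθ
  simp only [Metric.mem_closedBall, dist_zero_right, Prod.norm_def, sup_le_iff]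
  exact ⟨h2, by linarith⟩

theorem volume_directionSet_ne_zero (hd : 1 ≤ d) : volume (directionSet d k) ≠ 0 := by
  have : Nonempty (Fin d) := ⟨⟨0, hd⟩⟩
  have : Nontrivial (EuclideanSpace ℝ (Fin d)) := inferInstance
  obtain ⟨ω, hω⟩ := exists_norm_eq (EuclideanSpace ℝ (Fin d)) (show (0 : ℝ) ≤ 3 / 2 by norm_num)
  have ho : IsOpen {θ : GrushinSpace d k | (1 < ‖θ.1‖ ∧ ‖θ.1‖ < 2) ∧ ‖θ.2‖ < 1} := by
    refine ((isOpen_lt ?_ ?_).and (isOpen_lt ?_ ?_)).and (isOpen_lt ?_ ?_) <;> fun_prop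
  refine (lt_of_lt_of_le (ho.measure_pos volume ⟨(ω, 0), ?_⟩) (measure_mono ?_)).ne'
  · simp only [mem_ofPred_eq, hω, norm_zero]
    norm_num
  · exact fun θ hθ => ⟨⟨hθ.1.1.le, hθ.1.2.le⟩, hθ.2.le⟩

theorem isAddHaarMeasure_volume :
    (volume : Measure (GrushinSpace d k)).IsAddHaarMeasure := by
  rw [Measure.volume_eq_prod]
  infer_instance

theorem measurePreserving_neg_fst :
    MeasurePreserving (fun θ : GrushinSpace d k => ((-θ.1, θ.2) : GrushinSpace d k)) :=
  (Measure.measurePreserving_neg (volume : Measure (EuclideanSpace ℝ (Fin d)))).prod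
    (MeasurePreserving.id (volume : Measure (EuclideanSpace ℝ (Fin k))))

theorem setLIntegral_directionSet_neg_fst {F : GrushinSpace d k → ℝ≥0∞} (hF : Measurable F) :
    ∫⁻ θ in directionSet d k, F (-θ.1, θ.2) = ∫⁻ θ in directionSet d k, F θ := by
  have h := measurePreserving_neg_fst.setLIntegral_comp_preimage
    (measurableSet_directionSet (d := d) (k := k)) hF
  have hpre : (fun θ : GrushinSpace d k => ((-θ.1, θ.2) : GrushinSpace d k)) ⁻¹' directionSet d k =
      directionSet d k := by
    ext θ; simp [directionSet]
  rwa [hpre] at h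

theorem volume_mul_enorm_le (hμ : 0 < μ) (hu : ContDiff ℝ 1 u) (hc : HasCompactSupport u)
    (z : GrushinSpace d k) :
    volume (directionSet d k) * ‖u z‖ₑ ≤ ENNReal.ofReal (3 + μ) * (2 *
      ∫⁻ θ in directionSet d k, ∫⁻ r in Ioi (0 : ℝ),
        ENNReal.ofReal (gradMuSum μ u (z + dilation μ r θ))) := by
  set F : GrushinSpace d k → ℝ≥0∞ := fun θ => ∫⁻ r in Ioi (0 : ℝ),
        ENNReal.ofReal (gradMuSum μ u (z + dilation μ r θ)) with hF
  have hFm : Measurable F := by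
    have h1 : Measurable fun w : GrushinSpace d k × ℝ =>
        ENNReal.ofReal (gradMuSum μ u (z + dilation μ w.2 w.1)) := by
      have h2 : Measurable fun w => ENNReal.ofReal (gradMuSum μ u w) :=
        (continuous_gradMuSum hμ hu).measurable.ennreal_ofReal
      refine Measurable.comp (g := fun w => ENNReal.ofReal (gradMuSum μ u w)) h2 ?_
      unfold dilation; fun_prop
    exact h1.lintegral_prod_right'
  have hpt : ∀ θ ∈ directionSet d k,
      ‖u z‖ₑ ≤ ENNReal.ofReal (3 + μ) * (F θ + F (-θ.1, θ.2)) := by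
    rintro θ ⟨⟨h1, h2⟩, h3⟩
    rcases le_total 0 ⟪z.1, θ.1⟫ with h | h
    · refine (enorm_le_lintegral_gradMuSum_of_inner_nonneg hμ hu hc h1 h2 h3 h).trans ?_
      gcongr
      exact le_self_add
    · refine (enorm_le_lintegral_gradMuSum_of_inner_nonneg hμ hu hc (θ := (-θ.1, θ.2))
        (by simpa) (by simpa) h3 (by simpa)).trans ?_
      gcongr
      exact le_add_self
  calc volume (directionSet d k) * ‖u z‖ₑ = ∫⁻ _ in directionSet d k, ‖u z‖ₑ := by
        rw [setLIntegral_const, mul_comm]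
    _ ≤ ∫⁻ θ in directionSet d k, ENNReal.ofReal (3 + μ) * (F θ + F (-θ.1, θ.2)) :=
        setLIntegral_mono' measurableSet_directionSet hpt
    _ = _ := by
        rw [lintegral_const_mul' _ _ ENNReal.ofReal_ne_top, lintegral_add_left hFm,
          setLIntegral_directionSet_neg_fst hFm, two_mul]

theorem setLIntegral_rpow_neg {Q R : ℝ} (hQ : 1 < Q) (hR : 0 < R) :
    ∫⁻ r in Ioi R, ENNReal.ofReal (r ^ (-Q)) = ENNReal.ofReal (R ^ (1 - Q) / (Q - 1)) := by
  rw [← ofReal_integral_eq_lintegral_ofReal (integrableOn_Ioi_rpow_of_lt (by linarith) hR),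
    integral_Ioi_rpow_of_lt (by linarith) hR]
  · congr 1
    rw [show -Q + 1 = 1 - Q by ring, show 1 - Q = -(Q - 1) by ring, div_neg, neg_div, neg_neg]
  · filter_upwards [ae_restrict_mem measurableSet_Ioi] with r hr
    have : 0 < r := hR.trans hr
    simp only [Pi.zero_apply]
    positivity

/-- Averages over small anisotropic boxes are controlled by the `L¹` norm, averages over large ones
by the `L¹` norm divided by the volume; integrating over all scales gives a weak type bound. -/
theorem exists_setLIntegral_dilation_le (hQ : 1 < d + (1 + μ) * k)
    {B : Set (GrushinSpace d k)} (hBtop : volume B ≠ ∞) :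
    ∃ C : ℝ≥0∞, C ≠ ∞ ∧ ∀ (h : GrushinSpace d k → ℝ≥0∞) (E : Set (GrushinSpace d k)),
      Measurable h → volume E ≠ ∞ →
      ∫⁻ z in E, ∫⁻ θ in B, ∫⁻ r in Ioi (0 : ℝ), h (z + dilation μ r θ) ≤
        C * volume E ^ (1 / (d + (1 + μ) * k)) * ∫⁻ z, h z := by
  set Q := d + (1 + μ) * k with hQdef
  refine ⟨volume B + ENNReal.ofReal (1 / (Q - 1)), ENNReal.add_ne_top.2
    ⟨hBtop, ENNReal.ofReal_ne_top⟩, fun h E hh hE => ?_⟩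
  rcases eq_or_ne (volume E) 0 with hE0 | hE0
  · rw [setLIntegral_measure_zero _ _ hE0]
    exact zero_le
  have := isAddHaarMeasure_volume (d := d) (k := k)
  set R := (volume E).toReal ^ (1 / Q) with hR
  have hEpos : 0 < (volume E).toReal := ENNReal.toReal_pos hE0 hE
  have hRpos : 0 < R := by positivity
  have hER : volume E = ENNReal.ofReal (R ^ Q) := by
    rw [hR, ← Real.rpow_mul hEpos.le, one_div, inv_mul_cancel₀ (by linarith), Real.rpow_one,
      ENNReal.ofReal_toReal hE]
  have hER' : volume E ^ (1 / Q) = ENNReal.ofReal R := by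
    rw [hR, ← ENNReal.ofReal_rpow_of_pos hEpos, ENNReal.ofReal_toReal hE]
  set J : ℝ → ℝ≥0∞ := fun r => ∫⁻ z in E, ∫⁻ θ in B, h (z + dilation μ r θ) with hJ
  have hjoint : Measurable fun w : (GrushinSpace d k × GrushinSpace d k) × ℝ =>
      h (w.1.1 + dilation μ w.2 w.1.2) := by
    refine hh.comp ?_
    unfold dilation; fun_prop
  have hswap : ∫⁻ z in E, ∫⁻ θ in B, ∫⁻ r in Ioi (0 : ℝ), h (z + dilation μ r θ) =
      ∫⁻ r in Ioi (0 : ℝ), J r := by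
    have e1 : ∀ z : GrushinSpace d k, ∫⁻ θ in B, ∫⁻ r in Ioi (0 : ℝ), h (z + dilation μ r θ) =
        ∫⁻ r in Ioi (0 : ℝ), ∫⁻ θ in B, h (z + dilation μ r θ) := fun z => by
      rw [lintegral_lintegral_swap]
      apply Measurable.aemeasurable
      exact Measurable.comp (f := fun w : GrushinSpace d k × ℝ => ((z, w.1), w.2)) hjoint
        (by fun_prop)
    simp only [e1, hJ]
    rw [lintegral_lintegral_swap]
    apply Measurable.aemeasurable
    have e2 : Measurable fun w : (GrushinSpace d k × ℝ) × GrushinSpace d k =>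
        h (w.1.1 + dilation μ w.1.2 w.2) :=
      Measurable.comp (f := fun w : (GrushinSpace d k × ℝ) × GrushinSpace d k =>
        ((w.1.1, w.2), w.1.2)) hjoint (by fun_prop)
    exact e2.lintegral_prod_right'
  have hsmall : ∀ r, J r ≤ volume B * ∫⁻ z, h z := fun r => by
    have e1 : J r = ∫⁻ θ in B, ∫⁻ z in E, h (z + dilation μ r θ) := by
      simp only [hJ]
      rw [lintegral_lintegral_swap]
      apply Measurable.aemeasurable
      exact Measurable.comp (f := fun w : GrushinSpace d k × GrushinSpace d k => (w, r)) hjoint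
        (by fun_prop)
    rw [e1]
    calc ∫⁻ θ in B, ∫⁻ z in E, h (z + dilation μ r θ)
        ≤ ∫⁻ θ in B, ∫⁻ z, h z := by
          refine lintegral_mono fun θ => (setLIntegral_le_lintegral _ _).trans_eq ?_
          exact lintegral_add_right_eq_self h (dilation μ r θ)
      _ = _ := by rw [setLIntegral_const, mul_comm]
  have hlarge : ∀ r, 0 < r → J r ≤ volume E * ENNReal.ofReal (r ^ (-Q)) * ∫⁻ z, h z := by
    intro r hr
    calc J r ≤ ∫⁻ z in E, ENNReal.ofReal (r ^ (-Q)) * ∫⁻ z, h z := by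
          refine lintegral_mono fun z => (setLIntegral_le_lintegral _ _).trans_eq ?_
          rw [lintegral_comp_dilation μ (f := fun w => h (z + w)) (by fun_prop) hr,
            lintegral_add_left_eq_self h z]
      _ = _ := by rw [setLIntegral_const]; ring
  rw [hswap, hER', ← Ioc_union_Ioi_eq_Ioi hRpos.le]
  refine (lintegral_union_le _ _ _).trans ?_
  have i1 : ∫⁻ r in Ioc 0 R, J r ≤ volume B * ENNReal.ofReal R * ∫⁻ z, h z := by
    refine (lintegral_mono fun r => hsmall r).trans_eq ?_
    rw [setLIntegral_const, Real.volume_Ioc, sub_zero]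
    ring
  have i2 : ∫⁻ r in Ioi R, J r ≤ ENNReal.ofReal (1 / (Q - 1)) * ENNReal.ofReal R * ∫⁻ z, h z := by
    refine (setLIntegral_mono' measurableSet_Ioi
      fun r hr => hlarge r (hRpos.trans hr)).trans_eq ?_
    rw [lintegral_mul_const _ (by fun_prop), lintegral_const_mul' _ _ hE,
      setLIntegral_rpow_neg hQ hRpos, hER, ← ENNReal.ofReal_mul (by positivity),
      ← ENNReal.ofReal_mul (by have := sub_pos.2 hQ; positivity)]
    congr 2
    rw [mul_div_assoc', ← Real.rpow_add hRpos]
    simp only [add_sub_cancel, Real.rpow_one]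
    ring
  refine (add_le_add i1 i2).trans_eq ?_
  ring

/-- Weak type form of the Sobolev inequality in `L¹`. -/
theorem exists_setLIntegral_enorm_le (hd : 1 ≤ d) (hμ : 0 < μ) (hQ : 1 < d + (1 + μ) * k) :
    ∃ C : ℝ≥0∞, C ≠ ∞ ∧ ∀ (u : GrushinSpace d k → ℝ) (E : Set (GrushinSpace d k)),
      ContDiff ℝ 1 u → HasCompactSupport u → volume E ≠ ∞ →
      ∫⁻ z in E, ‖u z‖ₑ ≤
        C * volume E ^ (1 / (d + (1 + μ) * k)) * ∫⁻ z, ENNReal.ofReal (gradMuSum μ u z) := by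
  set Q := d + (1 + μ) * k with hQdef
  obtain ⟨C, hC, hCle⟩ := exists_setLIntegral_dilation_le hQ (volume_directionSet_ne_top (d := d))
  set b := volume (directionSet d k)
  have hb0 : b ≠ 0 := volume_directionSet_ne_zero hd
  have hbt : b ≠ ∞ := volume_directionSet_ne_top
  set c := b⁻¹ * (ENNReal.ofReal (3 + μ) * 2) with hcdef
  have hct : c ≠ ∞ := ENNReal.mul_ne_top (ENNReal.inv_ne_top.2 hb0)
    (ENNReal.mul_ne_top ENNReal.ofReal_ne_top (by norm_num))
  refine ⟨c * C, ENNReal.mul_ne_top hct hC, fun u E hu hc hE => ?_⟩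
  calc ∫⁻ z in E, ‖u z‖ₑ ≤ ∫⁻ z in E, c * ∫⁻ θ in directionSet d k, ∫⁻ r in Ioi (0 : ℝ),
        ENNReal.ofReal (gradMuSum μ u (z + dilation μ r θ)) := by
        refine lintegral_mono fun z => ?_
        have h := volume_mul_enorm_le hμ hu hc z
        calc ‖u z‖ₑ = b⁻¹ * (b * ‖u z‖ₑ) := by
              rw [← mul_assoc, ENNReal.inv_mul_cancel hb0 hbt, one_mul]
          _ ≤ b⁻¹ * _ := mul_le_mul' le_rfl h
          _ = _ := by rw [hcdef]; ring
    _ ≤ c * (C * volume E ^ (1 / Q) * ∫⁻ z, ENNReal.ofReal (gradMuSum μ u z)) := by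
        rw [lintegral_const_mul' _ _ hct]
        gcongr
        exact hCle (fun z => ENNReal.ofReal (gradMuSum μ u z)) E
          (continuous_gradMuSum hμ hu).measurable.ennreal_ofReal hE
    _ = _ := by ring

end weakType

section truncation

theorem exists_cutoff : ∃ (η : ℝ → ℝ) (K : ℝ), 0 ≤ K ∧ ContDiff ℝ 1 η ∧ η 0 = 0 ∧
    (∀ t, 2 ≤ |t| → η t = 1) ∧ (∀ t, |deriv η t| ≤ K) ∧
    ∀ t, |t| ∉ Ico (1 : ℝ) 2 → deriv η t = 0 := by
  set η : ℝ → ℝ := fun t => Real.smoothTransition (t ^ 2 - 1) with hη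
  have hsmooth : ContDiff ℝ 1 η := by
    have : ContDiff ℝ 1 Real.smoothTransition := Real.smoothTransition.contDiff (n := 1)
    exact this.comp (by fun_prop)
  have hone : ∀ t : ℝ, 2 ≤ |t| → 1 < t ^ 2 - 1 := fun t ht => by
    rw [← sq_abs]; nlinarith
  have houter : ∀ t, 2 ≤ |t| → deriv η t = 0 := fun t ht => by
    have : η =ᶠ[𝓝 t] fun _ => 1 := by
      filter_upwards [(show Continuous fun t : ℝ => t ^ 2 - 1 by fun_prop).continuousAt.eventually
        (lt_mem_nhds (hone t ht))] with s hs
      exact Real.smoothTransition.one_of_one_le hs.le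
    rw [this.deriv_eq, deriv_const]
  have hinner : ∀ t, |t| < 1 → deriv η t = 0 := fun t ht => by
    have : η =ᶠ[𝓝 t] fun _ => 0 := by
      filter_upwards [(continuous_abs (G := ℝ)).continuousAt.eventually (gt_mem_nhds ht)] with s hs
      refine Real.smoothTransition.zero_of_nonpos ?_
      rw [← sq_abs]; nlinarith [abs_nonneg s]
    rw [this.deriv_eq, deriv_const]
  obtain ⟨K, hK⟩ := (isCompact_Icc (a := (-2 : ℝ)) (b := 2)).exists_bound_of_continuousOn
    (hsmooth.continuous_deriv le_rfl).continuousOn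
  have hK0 : 0 ≤ K := (norm_nonneg _).trans (hK 0 (by norm_num))
  refine ⟨η, K, hK0, hsmooth, Real.smoothTransition.zero_of_nonpos (by norm_num),
    fun t ht => Real.smoothTransition.one_of_one_le (hone t ht).le, fun t => ?_, fun t ht => ?_⟩
  · rcases le_total |t| 2 with h | h
    · exact hK t (abs_le.1 h)
    · simpa [houter t h] using hK0
  · rcases lt_or_ge |t| 1 with h | h
    · exact hinner t h
    · exact houter t (not_lt.1 fun h' => ht ⟨h, h'⟩)

variable {d k : ℕ} {μ : ℝ}

/-- The dyadic layer `{a ≤ |u| < 2a}`. -/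
def dyadicLayer (u : GrushinSpace d k → ℝ) (a : ℝ) : Set (GrushinSpace d k) :=
  {z | |u z| ∈ Ico a (2 * a)}

theorem measurableSet_dyadicLayer {u : GrushinSpace d k → ℝ} (hu : Continuous u) (a : ℝ) :
    MeasurableSet (dyadicLayer u a) :=
  measurableSet_Ico.preimage hu.abs.measurable

theorem volume_dyadicLayer_ne_top {u : GrushinSpace d k → ℝ} (hc : HasCompactSupport u) {a : ℝ}
    (ha : 0 < a) : volume (dyadicLayer u a) ≠ ∞ := by
  refine ((measure_mono fun z hz => ?_).trans_lt hc.isCompact.measure_lt_top).ne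
  refine subset_tsupport _ fun h => ?_
  have := hz.1
  rw [h, abs_zero] at this
  linarith

theorem exists_volume_dyadicLayer_le (hd : 1 ≤ d) (hμ : 0 < μ)
    (hQ : 1 < d + (1 + μ) * k) : ∃ C ≠ ∞, ∀ (u : GrushinSpace d k → ℝ) (a : ℝ),
      ContDiff ℝ 1 u → HasCompactSupport u → 0 < a →
      volume (dyadicLayer u (2 * a)) ≤
        C * volume (dyadicLayer u (2 * a)) ^ (1 / (d + (1 + μ) * k)) *
          ((ENNReal.ofReal a)⁻¹ *
            ∫⁻ z in dyadicLayer u a, ENNReal.ofReal (gradMuSum μ u z)) := by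
  obtain ⟨C, hC, h⟩ := exists_setLIntegral_enorm_le hd hμ hQ
  obtain ⟨η, K, hK0, hη, h0, h1, hK, hz⟩ := exists_cutoff
  refine ⟨C * ENNReal.ofReal K, ENNReal.mul_ne_top hC ENNReal.ofReal_ne_top,
    fun u a hu hc ha => ?_⟩
  have hφ : ContDiff ℝ 1 fun t => η (t / a) := hη.comp (by fun_prop)
  have hderiv : ∀ t, deriv (fun t => η (t / a)) t = deriv η (t / a) / a := fun t => by
    have e := ((hη.differentiable one_ne_zero (t / a)).hasDerivAt.comp t
      ((hasDerivAt_id t).div_const a)).deriv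
    have e' : deriv (fun t => η (t / a)) t = deriv (η ∘ fun x => id x / a) t := rfl
    rw [e', e]
    ring
  have hv : ContDiff ℝ 1 fun z => η (u z / a) := hφ.comp hu
  have hvc : HasCompactSupport fun z => η (u z / a) :=
    hc.comp_left (g := fun t => η (t / a)) (by simpa using h0)
  have hm := measurableSet_dyadicLayer hu.continuous a
  have hm2 := measurableSet_dyadicLayer hu.continuous (2 * a)
  have hgrad : ∫⁻ z, ENNReal.ofReal (gradMuSum μ (fun z => η (u z / a)) z) ≤
      ENNReal.ofReal K * ((ENNReal.ofReal a)⁻¹ *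
        ∫⁻ z in dyadicLayer u a, ENNReal.ofReal (gradMuSum μ u z)) := by
    rw [← lintegral_indicator hm, ← mul_assoc, ← lintegral_const_mul' _ _
      (ENNReal.mul_ne_top ENNReal.ofReal_ne_top (by simpa using ha))]
    refine lintegral_mono fun z => ?_
    rw [gradMuSum_comp (hφ.differentiable one_ne_zero _) (hu.differentiable one_ne_zero z),
      hderiv, abs_div, abs_of_pos ha, ← ENNReal.ofReal_inv_of_pos ha]
    by_cases hzL : z ∈ dyadicLayer u a
    · rw [indicator_of_mem hzL, ← ENNReal.ofReal_mul hK0, ← ENNReal.ofReal_mul (by positivity)]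
      refine ENNReal.ofReal_le_ofReal (mul_le_mul_of_nonneg_right ?_ gradMuSum_nonneg)
      rw [div_eq_mul_inv]
      exact mul_le_mul_of_nonneg_right (hK _) (by positivity)
    · rw [hz]
      · simp
      · rw [abs_div, abs_of_pos ha, mem_Ico, le_div_iff₀ ha, div_lt_iff₀ ha, one_mul]
        exact hzL
  have hone : ∫⁻ z in dyadicLayer u (2 * a), ‖η (u z / a)‖ₑ = volume (dyadicLayer u (2 * a)) := by
    rw [← setLIntegral_one]
    refine setLIntegral_congr_fun hm2 fun z hzL => ?_
    have : η (u z / a) = 1 := h1 _ (by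
      rw [abs_div, abs_of_pos ha, le_div_iff₀ ha]
      exact hzL.1)
    simp [this]
  calc volume (dyadicLayer u (2 * a))
      = ∫⁻ z in dyadicLayer u (2 * a), ‖η (u z / a)‖ₑ := hone.symm
    _ ≤ _ := h _ _ hv hvc (volume_dyadicLayer_ne_top hc (by positivity))
    _ ≤ _ := by
      refine (mul_le_mul_right hgrad _).trans_eq ?_
      ring

theorem ENNReal.le_rpow_of_le_mul_rpow {x A : ℝ≥0∞} {θ : ℝ} (hx : x ≠ ∞) (h1 : θ < 1)
    (h : x ≤ A * x ^ θ) : x ≤ A ^ (1 / (1 - θ)) := by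
  rcases eq_or_ne x 0 with rfl | h0
  · exact zero_le
  have h1' : 0 < 1 - θ := by linarith
  rw [one_div, ENNReal.le_rpow_inv_iff h1', ENNReal.rpow_sub _ _ h0 hx, ENNReal.rpow_one]
  refine ENNReal.div_le_of_le_mul h

theorem ENNReal.tsum_rpow_le_rpow_tsum {ι : Type*} {q : ℝ} (hq : 1 ≤ q) (a : ι → ℝ≥0∞) :
    ∑' i, a i ^ q ≤ (∑' i, a i) ^ q := by
  have hsplit : ∀ x : ℝ≥0∞, x ^ q = x ^ (q - 1) * x := fun x => by
    conv_lhs => rw [← sub_add_cancel q 1]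
    rw [ENNReal.rpow_add_of_nonneg _ _ (by linarith) zero_le_one, ENNReal.rpow_one]
  rw [hsplit (∑' i, a i), ← ENNReal.tsum_mul_left]
  refine ENNReal.tsum_le_tsum fun i => ?_
  rw [hsplit]
  gcongr ?_ * _
  exact ENNReal.rpow_le_rpow (ENNReal.le_tsum i) (by linarith)

theorem tsum_le_of_succ_le {b G : ℤ → ℝ≥0∞} {K : ℝ≥0∞} {p q : ℝ} (hp : 1 ≤ p) (hq : 1 ≤ q)
    (hpq : q * (1 - 1 / p) < 1) (hS : ∑' j, b j ≠ ∞)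
    (h : ∀ j, b (j + 1) ≤ K * (b j ^ (1 - 1 / p) * G j ^ (1 / p)) ^ q) :
    ∑' j, b j ≤ (K * (∑' j, G j) ^ (q / p)) ^ (1 / (1 - q * (1 - 1 / p))) := by
  have hp' : 1 / p ≤ 1 := by rw [div_le_one (by linarith)]; exact hp
  have hp0 : 0 ≤ 1 / p := by positivity
  refine ENNReal.le_rpow_of_le_mul_rpow hS hpq ?_
  have hold : ∑' j, b j ^ (1 - 1 / p) * G j ^ (1 / p) ≤
      (∑' j, b j) ^ (1 - 1 / p) * (∑' j, G j) ^ (1 / p) := by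
    simpa only [lintegral_count] using ENNReal.lintegral_mul_norm_pow_le
      (μ := Measure.count) (f := b) (g := G)
      (measurable_of_countable b).aemeasurable (measurable_of_countable G).aemeasurable
      (sub_nonneg.2 hp') hp0 (by ring)
  calc ∑' j, b j = ∑' j, b (j + 1) := ((Equiv.addRight (1 : ℤ)).tsum_eq b).symm
    _ ≤ ∑' j, K * (b j ^ (1 - 1 / p) * G j ^ (1 / p)) ^ q := ENNReal.tsum_le_tsum h
    _ ≤ K * ((∑' j, b j) ^ (1 - 1 / p) * (∑' j, G j) ^ (1 / p)) ^ q := by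
      rw [ENNReal.tsum_mul_left]
      gcongr
      exact (ENNReal.tsum_rpow_le_rpow_tsum hq _).trans (by gcongr)
    _ = _ := by
      rw [ENNReal.mul_rpow_of_nonneg _ _ (by linarith), ← ENNReal.rpow_mul, ← ENNReal.rpow_mul,
        mul_comm (1 - 1 / p) q, one_div_mul_eq_div, mul_assoc, mul_comm (_ ^ (q / p))]

end truncation

section sobolev

variable {d k : ℕ} {μ : ℝ}

theorem pairwise_disjoint_dyadicLayer (u : GrushinSpace d k → ℝ) :
    Pairwise (Function.onFun Disjoint fun j : ℤ => dyadicLayer u ((2 : ℝ) ^ j)) := by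
  have hmono : Monotone fun j : ℤ => (2 : ℝ) ^ j := zpow_right_mono₀ one_le_two
  intro i j hij
  have := hmono.pairwise_disjoint_on_Ico_succ hij
  simp only [Function.onFun, Order.succ_eq_add_one, zpow_add_one₀ (two_ne_zero' ℝ)] at this
  simp only [mul_comm _ (2 : ℝ)] at this
  exact this.preimage fun z => |u z|

theorem mem_iUnion_dyadicLayer {u : GrushinSpace d k → ℝ} {z : GrushinSpace d k}
    (hz : u z ≠ 0) : z ∈ ⋃ j : ℤ, dyadicLayer u ((2 : ℝ) ^ j) := by
  obtain ⟨n, hn⟩ := _root_.exists_mem_Ico_zpow (abs_pos.2 hz) (one_lt_two (α := ℝ))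
  rw [zpow_add_one₀ (two_ne_zero' ℝ), mul_comm] at hn
  exact mem_iUnion.2 ⟨n, hn⟩

theorem rpow_mul_volume_dyadicLayer_le {P a : ℝ} (hP : 0 ≤ P) {u : GrushinSpace d k → ℝ}
    (hu : Continuous u) :
    ENNReal.ofReal a ^ P * volume (dyadicLayer u a) ≤ ∫⁻ z in dyadicLayer u a, ‖u z‖ₑ ^ P := by
  rw [← setLIntegral_const]
  refine setLIntegral_mono' (measurableSet_dyadicLayer hu a) fun z hz => ?_
  rw [Real.enorm_eq_ofReal_abs]
  exact ENNReal.rpow_le_rpow (ENNReal.ofReal_le_ofReal hz.1) hP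

theorem setLIntegral_dyadicLayer_rpow_le {P a : ℝ} (hP : 0 ≤ P) {u : GrushinSpace d k → ℝ}
    (hu : Continuous u) : ∫⁻ z in dyadicLayer u a, ‖u z‖ₑ ^ P ≤
      2 ^ P * (ENNReal.ofReal a ^ P * volume (dyadicLayer u a)) := by
  rw [← mul_assoc, ← ENNReal.mul_rpow_of_nonneg _ _ hP, ← setLIntegral_const]
  refine setLIntegral_mono' (measurableSet_dyadicLayer hu a) fun z hz => ?_
  rw [Real.enorm_eq_ofReal_abs, ← ENNReal.ofReal_ofNat, ← ENNReal.ofReal_mul zero_le_two]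
  exact ENNReal.rpow_le_rpow (ENNReal.ofReal_le_ofReal hz.2.le) hP

theorem exists_rpow_mul_volume_dyadicLayer_le (hd : 1 ≤ d) (hμ : 0 < μ) {p Q : ℝ} (hp : 1 < p)
    (hQ : Q = d + (1 + μ) * k) (hpQ : p < Q) :
    ∃ C ≠ ∞, ∀ (u : GrushinSpace d k → ℝ) (a : ℝ), ContDiff ℝ 1 u → HasCompactSupport u → 0 < a →
      ENNReal.ofReal (2 * a) ^ (p * Q / (Q - p)) * volume (dyadicLayer u (2 * a)) ≤
        C * ((ENNReal.ofReal a ^ (p * Q / (Q - p)) * volume (dyadicLayer u a)) ^ (1 - 1 / p) *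
          (∫⁻ z in dyadicLayer u a, ENNReal.ofReal (gradMuSum μ u z) ^ p) ^ (1 / p)) ^
            (Q / (Q - 1)) := by
  obtain ⟨C, hC, h⟩ := exists_volume_dyadicLayer_le hd hμ (hQ ▸ hp.trans hpQ)
  rw [← hQ] at h
  have hQp : 0 < Q - p := by linarith
  have hQ1 : 0 < Q - 1 := by linarith
  have hQ0 : 0 < Q := by linarith
  have hp0 : 0 < p := by linarith
  have hpp : 0 ≤ 1 - 1 / p := by rw [sub_nonneg, div_le_one hp0]; exact hp.le
  have hq : 0 ≤ Q / (Q - 1) := by positivity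
  have hP : 0 ≤ p * Q / (Q - p) := by positivity
  refine ⟨2 ^ (p * Q / (Q - p)) * C ^ (Q / (Q - 1)), ENNReal.mul_ne_top
    (ENNReal.rpow_ne_top_of_nonneg hP (by simp)) (ENNReal.rpow_ne_top_of_nonneg hq hC),
    fun u a hu hc ha => ?_⟩
  set e := ENNReal.ofReal a
  have he0 : e ≠ 0 := by simpa [e] using ha
  have het : e ≠ ∞ := ENNReal.ofReal_ne_top
  set M := volume (dyadicLayer u a)
  set M₂ := volume (dyadicLayer u (2 * a))
  set G := ∫⁻ z in dyadicLayer u a, ENNReal.ofReal (gradMuSum μ u z) ^ p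
  have hI : ∫⁻ z in dyadicLayer u a, ENNReal.ofReal (gradMuSum μ u z) ≤
      M ^ (1 - 1 / p) * G ^ (1 / p) := by
    have := ENNReal.lintegral_mul_norm_pow_le (μ := volume.restrict (dyadicLayer u a))
      (f := fun _ => 1) (g := fun z => ENNReal.ofReal (gradMuSum μ u z) ^ p)
      (p := 1 - 1 / p) (q := 1 / p) (by fun_prop)
      (((continuous_gradMuSum hμ hu).measurable.ennreal_ofReal.pow_const p).aemeasurable)
      hpp (by positivity) (by ring)
    simpa [← ENNReal.rpow_mul, mul_inv_cancel₀ hp0.ne'] using this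
  have h2 : M₂ ≤ (C * (e⁻¹ * (M ^ (1 - 1 / p) * G ^ (1 / p)))) ^ (Q / (Q - 1)) := by
    have h3 : M₂ ≤ C * (e⁻¹ * (M ^ (1 - 1 / p) * G ^ (1 / p))) * M₂ ^ (1 / Q) := by
      refine (h u a hu hc ha).trans ?_
      rw [mul_right_comm]
      gcongr
    have h4 := ENNReal.le_rpow_of_le_mul_rpow (volume_dyadicLayer_ne_top hc (by positivity))
      (by rw [div_lt_one hQ0]; linarith) h3
    rwa [show 1 / (1 - 1 / Q) = Q / (Q - 1) by field_simp] at h4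
  rw [ENNReal.ofReal_mul zero_le_two, ENNReal.ofReal_ofNat, ENNReal.mul_rpow_of_nonneg _ _ hP]
  refine (mul_le_mul_right h2 _).trans_eq ?_
  rw [ENNReal.mul_rpow_of_nonneg (e ^ _) M hpp, ← ENNReal.rpow_mul, mul_assoc (e ^ _),
    ENNReal.mul_rpow_of_nonneg C _ hq, ENNReal.mul_rpow_of_nonneg e⁻¹ _ hq,
    ENNReal.mul_rpow_of_nonneg (e ^ _) _ hq, ← ENNReal.rpow_mul, ENNReal.inv_rpow,
    ← ENNReal.rpow_neg]
  have hexp : e ^ (p * Q / (Q - p)) * e ^ (-(Q / (Q - 1))) =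
      e ^ (p * Q / (Q - p) * (1 - 1 / p) * (Q / (Q - 1))) := by
    rw [← ENNReal.rpow_add _ _ he0 het]
    congr 1
    field_simp
    ring
  rw [← hexp]
  ring

/-- The Sobolev inequality for the Grushin gradient. -/
theorem exists_lintegral_rpow_le_gradMuSum (hd : 1 ≤ d) (hμ : 0 < μ) {p Q : ℝ} (hp : 1 < p)
    (hQ : Q = d + (1 + μ) * k) (hpQ : p < Q) :
    ∃ C ≠ ∞, ∀ u : GrushinSpace d k → ℝ, ContDiff ℝ 1 u → HasCompactSupport u →
      ∫⁻ z, ‖u z‖ₑ ^ (p * Q / (Q - p)) ≤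
        C * (∫⁻ z, ENNReal.ofReal (gradMuSum μ u z) ^ p) ^ (Q / (Q - p)) := by
  obtain ⟨C, hC, h⟩ := exists_rpow_mul_volume_dyadicLayer_le hd hμ hp hQ hpQ
  have hQp : 0 < Q - p := by linarith
  have hQ1 : 0 < Q - 1 := by linarith
  have hQ0 : 0 < Q := by linarith
  have hp0 : 0 < p := by linarith
  have hP : 0 < p * Q / (Q - p) := by positivity
  have hθ : 1 - Q / (Q - 1) * (1 - 1 / p) = (Q - p) / ((Q - 1) * p) := by
    field_simp
    ring
  have hθ0 : 0 < (Q - p) / ((Q - 1) * p) := by positivity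
  refine ⟨2 ^ (p * Q / (Q - p)) * C ^ (1 / (1 - Q / (Q - 1) * (1 - 1 / p))), ENNReal.mul_ne_top
    (ENNReal.rpow_ne_top_of_nonneg hP.le (by simp))
    (ENNReal.rpow_ne_top_of_nonneg (by rw [hθ]; positivity) hC), fun u hu hc => ?_⟩
  set P := p * Q / (Q - p)
  have hmeas : ∀ j : ℤ, MeasurableSet (dyadicLayer u ((2 : ℝ) ^ j)) := fun j =>
    measurableSet_dyadicLayer hu.continuous _
  have hdisj := pairwise_disjoint_dyadicLayer u
  have hsum : ∀ f : GrushinSpace d k → ℝ≥0∞,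
      ∑' j : ℤ, ∫⁻ z in dyadicLayer u ((2 : ℝ) ^ j), f z ≤ ∫⁻ z, f z := fun f => by
    rw [← lintegral_iUnion hmeas hdisj]
    exact setLIntegral_le_lintegral _ _
  have hfin : ∫⁻ z, ‖u z‖ₑ ^ P ≠ ∞ := by
    have : Integrable (fun z => |u z| ^ P) :=
      (hu.continuous.abs.rpow_const fun _ => .inr hP.le).integrable_of_hasCompactSupport
        (hc.comp_left (g := fun t => |t| ^ P) (by simp [hP.ne']))
    have h' := this.lintegral_lt_top.ne
    refine ne_of_eq_of_ne (lintegral_congr fun z => ?_) h'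
    rw [Real.enorm_eq_ofReal_abs, ENNReal.ofReal_rpow_of_nonneg (abs_nonneg _) hP.le]
  set b : ℤ → ℝ≥0∞ := fun j =>
    ENNReal.ofReal ((2 : ℝ) ^ j) ^ P * volume (dyadicLayer u ((2 : ℝ) ^ j))
  have hb : ∑' j, b j ≠ ∞ := by
    refine ((ENNReal.tsum_le_tsum fun j => ?_).trans (hsum _)).trans_lt (lt_top_iff_ne_top.2 hfin)
      |>.ne
    exact rpow_mul_volume_dyadicLayer_le hP.le hu.continuous
  have hstep := tsum_le_of_succ_le (b := b) (K := C) (p := p) (q := Q / (Q - 1)) hp.le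
    (by rw [one_le_div hQ1]; linarith) (by linarith) hb
    (G := fun j => ∫⁻ z in dyadicLayer u ((2 : ℝ) ^ j), ENNReal.ofReal (gradMuSum μ u z) ^ p)
    fun j => by
      have := h u ((2 : ℝ) ^ j) hu hc (by positivity)
      simpa only [b, zpow_add_one₀ (two_ne_zero' ℝ), mul_comm _ (2 : ℝ)] using this
  have hsupp : ∫⁻ z in ⋃ j : ℤ, dyadicLayer u ((2 : ℝ) ^ j), ‖u z‖ₑ ^ P = ∫⁻ z, ‖u z‖ₑ ^ P := by
    refine setLIntegral_eq_of_support_subset fun z hz => mem_iUnion_dyadicLayer fun h0 => hz ?_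
    simp [h0, hP]
  calc ∫⁻ z, ‖u z‖ₑ ^ P
      = ∑' j : ℤ, ∫⁻ z in dyadicLayer u ((2 : ℝ) ^ j), ‖u z‖ₑ ^ P := by
        rw [← hsupp, lintegral_iUnion hmeas hdisj]
    _ ≤ ∑' j, 2 ^ P * b j := ENNReal.tsum_le_tsum fun j =>
        setLIntegral_dyadicLayer_rpow_le hP.le hu.continuous
    _ = 2 ^ P * ∑' j, b j := ENNReal.tsum_mul_left
    _ ≤ 2 ^ P * (C * (∫⁻ z, ENNReal.ofReal (gradMuSum μ u z) ^ p) ^ (Q / (Q - 1) / p)) ^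
          (1 / (1 - Q / (Q - 1) * (1 - 1 / p))) := by
        have hE : 0 ≤ 1 / (1 - Q / (Q - 1) * (1 - 1 / p)) := by rw [hθ]; positivity
        have hq : 0 ≤ Q / (Q - 1) / p := by positivity
        gcongr
        refine hstep.trans ?_
        gcongr
        exact hsum _
    _ = _ := by
        rw [ENNReal.mul_rpow_of_nonneg _ _ (by rw [hθ]; positivity), ← ENNReal.rpow_mul,
          ← mul_assoc]
        congr 2
        rw [hθ]
        field_simp

end sobolev

/-- The power `ρ^{2+2μ} = |x|^{2+2μ} + (1+μ)²|y|²` of the distance function. -/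
noncomputable def grushinGauge (μ : ℝ) {d k : ℕ} (z : GrushinSpace d k) : ℝ :=
  ‖z.1‖ ^ (2 + 2 * μ) + (1 + μ) ^ 2 * ‖z.2‖ ^ (2 : ℝ)

/-- The weight `|x|^μ ρ^{α-1-μ}` of the Hardy inequality. -/
noncomputable def hardyWeight (μ α : ℝ) {d k : ℕ} (z : GrushinSpace d k) : ℝ :=
  ‖z.1‖ ^ μ * grho μ z ^ (α - (1 + μ))

section gauge

variable {d k : ℕ} {μ α : ℝ} {u : GrushinSpace d k → ℝ} {z : GrushinSpace d k}

theorem grho_eq_gauge_rpow (z : GrushinSpace d k) :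
    grho μ z = grushinGauge μ z ^ (1 / (2 + 2 * μ)) := by
  rw [grho, grushinGauge, Real.rpow_two]

theorem grushinGauge_nonneg (z : GrushinSpace d k) : 0 ≤ grushinGauge μ z := by
  unfold grushinGauge; positivity

theorem grho_nonneg (z : GrushinSpace d k) : 0 ≤ grho μ z := by
  rw [grho_eq_gauge_rpow]
  exact Real.rpow_nonneg (grushinGauge_nonneg z) _

theorem hardyWeight_nonneg (z : GrushinSpace d k) : 0 ≤ hardyWeight μ α z :=
  mul_nonneg (by positivity) (Real.rpow_nonneg (grho_nonneg z) _)

theorem grushinGauge_pos (hμ : 0 < μ) (hz : z ≠ 0) : 0 < grushinGauge μ z := by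
  unfold grushinGauge
  by_cases h1 : z.1 = 0
  · have h2 : z.2 ≠ 0 := fun h2 => hz (Prod.ext h1 h2)
    positivity
  · positivity

theorem grho_pos (hμ : 0 < μ) (hz : z ≠ 0) : 0 < grho μ z := by
  rw [grho_eq_gauge_rpow]
  exact Real.rpow_pos_of_pos (grushinGauge_pos hμ hz) _

theorem grho_rpow (hμ : 0 < μ) (z : GrushinSpace d k) (β : ℝ) :
    grho μ z ^ ((2 + 2 * μ) * β) = grushinGauge μ z ^ β := by
  rw [grho_eq_gauge_rpow, ← Real.rpow_mul (grushinGauge_nonneg z)]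
  congr 1
  field_simp

theorem continuous_grho (hμ : 0 < μ) : Continuous (grho μ : GrushinSpace d k → ℝ) := by
  unfold grho
  have h1 : Continuous fun z : GrushinSpace d k => ‖z.1‖ ^ (2 + 2 * μ) :=
    continuous_fst.norm.rpow_const fun _ => .inr (by linarith)
  exact Continuous.rpow_const (by fun_prop) fun _ => .inr (by positivity)

theorem measurable_hardyWeight (hμ : 0 < μ) :
    Measurable (hardyWeight μ α : GrushinSpace d k → ℝ) := by
  have := (continuous_grho (d := d) (k := k) hμ).measurable
  unfold hardyWeight
  fun_prop

theorem grho_dilation (hμ : 0 < μ) {r : ℝ} (hr : 0 < r) (z : GrushinSpace d k) :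
    grho μ (dilation μ r z) = r * grho μ z := by
  have h : grushinGauge μ (dilation μ r z) = r ^ (2 + 2 * μ) * grushinGauge μ z := by
    simp only [grushinGauge, dilation, norm_smul, Real.norm_eq_abs, abs_of_pos hr,
      abs_of_pos (Real.rpow_pos_of_pos hr (1 + μ))]
    rw [Real.mul_rpow hr.le (norm_nonneg _), Real.mul_rpow (by positivity) (norm_nonneg _),
      ← Real.rpow_mul hr.le, show (1 + μ) * 2 = 2 + 2 * μ by ring]
    ring
  rw [grho_eq_gauge_rpow, grho_eq_gauge_rpow, h,
    Real.mul_rpow (by positivity) (grushinGauge_nonneg z), ← Real.rpow_mul hr.le,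
    mul_one_div_cancel (by linarith), Real.rpow_one]

theorem hardyWeight_dilation (hμ : 0 < μ) {r : ℝ} (hr : 0 < r) (z : GrushinSpace d k) :
    hardyWeight μ α (dilation μ r z) = r ^ (α - 1) * hardyWeight μ α z := by
  rw [hardyWeight, hardyWeight, grho_dilation hμ hr, Real.mul_rpow hr.le (grho_nonneg z)]
  simp only [dilation, norm_smul, Real.norm_eq_abs, abs_of_pos hr]
  rw [Real.mul_rpow hr.le (norm_nonneg _), show α - 1 = μ + (α - (1 + μ)) by ring,
    Real.rpow_add hr]
  ring

theorem norm_fst_rpow_le_gauge (hμ : 0 < μ) (z : GrushinSpace d k) :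
    ‖z.1‖ ^ (1 + μ) ≤ grushinGauge μ z ^ (1 / 2 : ℝ) := by
  rw [← Real.sqrt_eq_rpow]
  refine Real.le_sqrt_of_sq_le ?_
  rw [← Real.rpow_natCast, ← Real.rpow_mul (norm_nonneg _), grushinGauge,
    show (1 + μ) * (2 : ℕ) = 2 + 2 * μ by push_cast; ring]
  exact le_add_of_nonneg_right (by positivity)

theorem mul_norm_snd_le_gauge (z : GrushinSpace d k) :
    (1 + μ) * ‖z.2‖ ≤ grushinGauge μ z ^ (1 / 2 : ℝ) := by
  rw [← Real.sqrt_eq_rpow]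
  refine Real.le_sqrt_of_sq_le ?_
  rw [mul_pow, grushinGauge, Real.rpow_two]
  exact le_add_of_nonneg_left (by positivity)

theorem contDiff_grushinGauge (hμ : 0 < μ) :
    ContDiff ℝ 1 (grushinGauge μ : GrushinSpace d k → ℝ) := by
  unfold grushinGauge
  exact ((contDiff_norm_rpow (by linarith)).comp contDiff_fst).add
    (contDiff_const.mul ((contDiff_norm_rpow (by norm_num)).comp contDiff_snd))

theorem gradMuSum_grushinGauge_le (hμ : 0 < μ) (z : GrushinSpace d k) :
    gradMuSum μ (grushinGauge μ) z ≤ 4 * (1 + μ) * (‖z.1‖ ^ μ * grushinGauge μ z ^ (1 / 2 : ℝ)) := by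
  obtain ⟨x, y⟩ := z
  have hu := ((contDiff_grushinGauge (d := d) (k := k) hμ).differentiable one_ne_zero
    (x, y)).hasFDerivAt
  have h1 : HasFDerivAt (fun x' => grushinGauge μ (x', y))
      ((fderiv ℝ (grushinGauge μ) (x, y)).comp (.inl ℝ _ _)) x :=
    HasFDerivAt.comp x (f := fun x' => (x', y)) hu (hasFDerivAt_prodMk_left x y)
  have h2 : HasFDerivAt (fun y' => grushinGauge μ (x, y'))
      ((fderiv ℝ (grushinGauge μ) (x, y)).comp (.inr ℝ _ _)) y :=
    HasFDerivAt.comp y (f := fun y' => (x, y')) hu (hasFDerivAt_prodMk_right x y)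
  have hp : 1 < 2 + 2 * μ := by linarith
  rw [gradMuSum, ← h1.fderiv, ← h2.fderiv]
  simp only [grushinGauge]
  rw [fderiv_add_const, fderiv_const_add, norm_fderiv_norm_id_rpow x hp,
    fderiv_const_mul (differentiable_norm_rpow one_lt_two y), norm_smul,
    norm_fderiv_norm_id_rpow y one_lt_two, Real.norm_of_nonneg (by positivity)]
  have e1 := norm_fst_rpow_le_gauge hμ (x, y)
  have e2 := mul_norm_snd_le_gauge (μ := μ) (x, y)
  simp only [grushinGauge] at e1 e2
  set R := (‖x‖ ^ (2 + 2 * μ) + (1 + μ) ^ 2 * ‖y‖ ^ (2 : ℝ)) ^ (1 / 2 : ℝ)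
  have e3 : ‖x‖ ^ (2 + 2 * μ - 1) = ‖x‖ ^ μ * ‖x‖ ^ (1 + μ) := by
    rw [← Real.rpow_add_of_nonneg (norm_nonneg _) hμ.le (by linarith)]
    congr 1
    ring
  have e4 : ‖y‖ ^ ((2 : ℝ) - 1) = ‖y‖ := by norm_num
  rw [e3, e4]
  have hX : 0 ≤ (1 + μ) * ‖x‖ ^ μ := by positivity
  nlinarith [mul_le_mul_of_nonneg_left e1 hX, mul_le_mul_of_nonneg_left e2 hX]

theorem norm_rpow_mul_abs_eulerDeriv_le (hμ : 0 < μ) (z : GrushinSpace d k) :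
    ‖z.1‖ ^ μ * |eulerDeriv μ u z| ≤
      2 * grushinGauge μ z ^ (1 / 2 : ℝ) * gradMuSum μ u z := by
  by_cases hx : z.1 = 0
  · rw [hx, norm_zero, Real.zero_rpow hμ.ne', zero_mul]
    exact mul_nonneg (mul_nonneg zero_le_two (Real.rpow_nonneg (grushinGauge_nonneg z) _))
      gradMuSum_nonneg
  have hX : 0 < ‖z.1‖ ^ μ := by positivity
  have h := abs_fderiv_pair_le (u := u) (z := z) (μ := μ) (a := z.1) (b := (1 + μ) • z.2)
    (B := (1 + μ) * ‖z.2‖ / ‖z.1‖ ^ μ)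
    (by rw [div_mul_cancel₀ _ hX.ne', norm_smul, Real.norm_of_nonneg (by linarith)])
    (by positivity)
  refine (mul_le_mul_of_nonneg_left h hX.le).trans ?_
  rw [← mul_assoc]
  refine mul_le_mul_of_nonneg_right ?_ gradMuSum_nonneg
  rw [mul_add, mul_div_cancel₀ _ hX.ne']
  have e : ‖z.1‖ ^ μ * ‖z.1‖ = ‖z.1‖ ^ (1 + μ) := by
    rw [add_comm, Real.rpow_add_one (by positivity)]
  linarith [norm_fst_rpow_le_gauge hμ z, mul_norm_snd_le_gauge (μ := μ) z]

theorem gauge_half_mul (hμ : 0 < μ) (hz : z ≠ 0) :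
    grushinGauge μ z ^ (1 / 2 : ℝ) * grho μ z ^ (α - (1 + μ)) = grho μ z ^ α := by
  rw [← grho_rpow hμ, ← Real.rpow_add (grho_pos hμ hz)]
  congr 1
  ring

end gauge

section hardy

variable {d k : ℕ} {μ α : ℝ}

/-- The Hardy inequality for the Grushin gradient. -/
theorem exists_lintegral_hardyWeight_le (hd : 1 ≤ d) (hμ : 0 < μ) {p : ℝ} (hp : 1 < p)
    (hα : 0 < d + (1 + μ) * k + p * (α - 1)) :
    ∃ C ≠ ∞, ∀ u : GrushinSpace d k → ℝ, ContDiff ℝ 1 u → HasCompactSupport u →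
      ∫⁻ z, ENNReal.ofReal (hardyWeight μ α z * |u z|) ^ p ≤
        C * ∫⁻ z, ENNReal.ofReal (grho μ z ^ α * gradMuSum μ u z) ^ p := by
  have hp0 : 0 ≤ p := by linarith
  obtain ⟨C, hC, h⟩ := exists_lintegral_weight_le_eulerDeriv (d := d) (k := k) hd hμ hp
    (W := fun z => ENNReal.ofReal (hardyWeight μ α z) ^ p)
    ((measurable_hardyWeight hμ).ennreal_ofReal.pow_const p) (m := p * (α - 1))
    (fun t z => by
      rw [hardyWeight_dilation hμ (exp_pos t), ENNReal.ofReal_mul (by positivity),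
        ENNReal.mul_rpow_of_nonneg _ _ hp0, ENNReal.ofReal_rpow_of_nonneg (by positivity) hp0,
        ← Real.exp_mul, ← Real.exp_mul]
      congr 3
      ring) hα
  refine ⟨C * 2 ^ p, ENNReal.mul_ne_top hC (ENNReal.rpow_ne_top_of_nonneg hp0 (by simp)),
    fun u hu hc => ?_⟩
  have heq : ∀ v : GrushinSpace d k → ℝ, ∀ z,
      ENNReal.ofReal (hardyWeight μ α z) ^ p * ‖v z‖ₑ ^ p =
        ENNReal.ofReal (hardyWeight μ α z * |v z|) ^ p := fun v z => by
    rw [Real.enorm_eq_ofReal_abs, ENNReal.ofReal_mul (hardyWeight_nonneg z),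
      ENNReal.mul_rpow_of_nonneg _ _ hp0]
  have h' := h u hu hc
  simp only [heq] at h'
  refine h'.trans ?_
  rw [mul_assoc, ← lintegral_const_mul' _ _ (ENNReal.rpow_ne_top_of_nonneg hp0 (by simp))]
  gcongr C * ?_
  refine lintegral_mono_ae ((ae_ne_zero hd).mono fun z hz => ?_)
  rw [← ENNReal.mul_rpow_of_nonneg _ _ hp0, ← ENNReal.ofReal_ofNat,
    ← ENNReal.ofReal_mul zero_le_two]
  refine ENNReal.rpow_le_rpow (ENNReal.ofReal_le_ofReal ?_) hp0
  have h1 := mul_le_mul_of_nonneg_right (norm_rpow_mul_abs_eulerDeriv_le (u := u) hμ z)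
    (Real.rpow_nonneg (grho_nonneg (μ := μ) z) (α - (1 + μ)))
  rw [← gauge_half_mul (α := α) hμ hz]
  unfold hardyWeight
  linarith

end hardy

section weightedSobolev

variable {d k : ℕ} {μ α : ℝ}

theorem abs_deriv_regularized_rpow_le {n : ℕ} {β ε τ : ℝ} (hn : 1 ≤ n) (hβ : β ≤ n) (hε : 0 < ε)
    (hτ : 0 < τ) : DifferentiableAt ℝ (fun τ => τ ^ n * (τ + ε) ^ (β - n)) τ ∧
      |deriv (fun τ => τ ^ n * (τ + ε) ^ (β - n)) τ| ≤ (2 * n - β) * τ ^ (β - 1) := by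
  have hτε : 0 < τ + ε := by linarith
  have h1 : HasDerivAt (fun τ : ℝ => τ ^ n) (n * τ ^ (n - 1)) τ := hasDerivAt_pow n τ
  have h2 : HasDerivAt (fun τ : ℝ => (τ + ε) ^ (β - n))
      (1 * (β - n) * (τ + ε) ^ (β - n - 1)) τ :=
    ((hasDerivAt_id τ).add_const ε).rpow_const (.inl hτε.ne')
  have h := h1.mul h2
  have h' : HasDerivAt (fun τ : ℝ => τ ^ n * (τ + ε) ^ (β - n)) _ τ := h
  refine ⟨h'.differentiableAt, ?_⟩
  rw [h'.deriv]
  have e1 : (τ + ε) ^ (β - n) ≤ τ ^ (β - n) :=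
    Real.rpow_le_rpow_of_nonpos hτ (by linarith) (by linarith)
  have e2 : (τ + ε) ^ (β - n - 1) ≤ τ ^ (β - n - 1) :=
    Real.rpow_le_rpow_of_nonpos hτ (by linarith) (by linarith)
  have f1 : τ ^ (n - 1) * τ ^ (β - n) = τ ^ (β - 1) := by
    rw [← Real.rpow_natCast, ← Real.rpow_add hτ, Nat.cast_sub hn]
    congr 1
    push_cast
    ring
  have f2 : τ ^ n * τ ^ (β - n - 1) = τ ^ (β - 1) := by
    rw [← Real.rpow_natCast, ← Real.rpow_add hτ]
    congr 1
    ring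
  have hnβ : 0 ≤ n - β := by linarith
  have g1 : |n * τ ^ (n - 1) * (τ + ε) ^ (β - n)| ≤ n * τ ^ (β - 1) := by
    rw [abs_of_nonneg (by positivity), ← f1, mul_assoc]
    gcongr
  have g2 : |τ ^ n * (1 * (β - n) * (τ + ε) ^ (β - n - 1))| ≤ (n - β) * τ ^ (β - 1) := by
    rw [abs_mul, abs_mul, one_mul, abs_of_nonneg (by positivity), abs_of_nonpos (by linarith),
      abs_of_nonneg (by positivity), ← f2]
    calc τ ^ n * (-(β - n) * (τ + ε) ^ (β - n - 1))
        = (n - β) * (τ ^ n * (τ + ε) ^ (β - n - 1)) := by ring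
      _ ≤ _ := by gcongr
  refine (abs_add_le _ _).trans ?_
  linarith

/-- The regularization of `ρ^α u`, with `β = α / (2 + 2μ)`. -/
noncomputable def regularizedWeightMul (μ β : ℝ) (n : ℕ) (ε : ℝ) (u : GrushinSpace d k → ℝ)
    (z : GrushinSpace d k) : ℝ :=
  grushinGauge μ z ^ n * (grushinGauge μ z + ε) ^ (β - n) * u z

variable {u : GrushinSpace d k → ℝ} {β ε : ℝ} {n : ℕ}

theorem contDiff_regularizedWeightMul (hμ : 0 < μ) (hε : 0 < ε) (hu : ContDiff ℝ 1 u) :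
    ContDiff ℝ 1 (regularizedWeightMul μ β n ε u) := by
  have h := contDiff_grushinGauge (d := d) (k := k) hμ
  refine ((h.pow n).mul ((h.add contDiff_const).rpow_const_of_ne fun z => ?_)).mul hu
  have := grushinGauge_nonneg (μ := μ) z
  linarith

theorem gradMuSum_regularizedWeightMul_le (hμ : 0 < μ) (hε : 0 < ε) (hn : 1 ≤ n) (hβ : β ≤ n)
    (hαβ : α = (2 + 2 * μ) * β) (hu : ContDiff ℝ 1 u) {z : GrushinSpace d k} (hz : z ≠ 0) :
    gradMuSum μ (regularizedWeightMul μ β n ε u) z ≤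
      grho μ z ^ α * gradMuSum μ u z +
        (2 * n - β) * (4 * (1 + μ)) * (hardyWeight μ α z * |u z|) := by
  have hN := grushinGauge_pos hμ hz
  have hNd := (contDiff_grushinGauge (d := d) (k := k) hμ).differentiable one_ne_zero z
  obtain ⟨hF, hF'⟩ := abs_deriv_regularized_rpow_le hn hβ hε hN
  have hnβ : 0 ≤ n - β := by linarith
  have hn0 : (0 : ℝ) ≤ n := n.cast_nonneg
  set F : ℝ → ℝ := fun τ => τ ^ n * (τ + ε) ^ (β - n) with hFdef
  have hFu : DifferentiableAt ℝ (fun w : GrushinSpace d k => F (grushinGauge μ w)) z :=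
    DifferentiableAt.comp z (g := F) hF hNd
  have h1 := gradMuSum_mul_le (μ := μ) hFu (hu.differentiable one_ne_zero z)
  rw [gradMuSum_comp hF hNd] at h1
  have h2 : |F (grushinGauge μ z)| ≤ grho μ z ^ α := by
    rw [hαβ, grho_rpow hμ, abs_of_nonneg (by positivity), hFdef]
    calc grushinGauge μ z ^ n * (grushinGauge μ z + ε) ^ (β - n)
        ≤ grushinGauge μ z ^ n * grushinGauge μ z ^ (β - n) := by
          gcongr 1
          exact Real.rpow_le_rpow_of_nonpos hN (by linarith) (by linarith)
      _ = _ := by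
          rw [← Real.rpow_natCast, ← Real.rpow_add hN]
          congr 1
          ring
  have h3 : |deriv F (grushinGauge μ z)| * gradMuSum μ (grushinGauge μ) z ≤
      (2 * n - β) * (4 * (1 + μ)) * hardyWeight μ α z := by
    calc _ ≤ (2 * n - β) * grushinGauge μ z ^ (β - 1) *
          (4 * (1 + μ) * (‖z.1‖ ^ μ * grushinGauge μ z ^ (1 / 2 : ℝ))) :=
          mul_le_mul hF' (gradMuSum_grushinGauge_le hμ z) gradMuSum_nonneg
            (mul_nonneg (by linarith) (by positivity))
      _ = (2 * n - β) * (4 * (1 + μ)) * (‖z.1‖ ^ μ *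
          (grushinGauge μ z ^ (β - 1) * grushinGauge μ z ^ (1 / 2 : ℝ))) := by ring
      _ = _ := by
          rw [← Real.rpow_add hN, hardyWeight, hαβ, ← grho_rpow hμ]
          congr 3
          ring
  have h4 := mul_le_mul_of_nonneg_right h2 (gradMuSum_nonneg (μ := μ) (u := u) (z := z))
  have h5 := mul_le_mul_of_nonneg_left h3 (abs_nonneg (u z))
  have h6 : gradMuSum μ (regularizedWeightMul μ β n ε u) z =
      gradMuSum μ (fun w => F (grushinGauge μ w) * u w) z := rfl
  rw [h6]
  linarith

theorem tendsto_regularizedWeightMul (hμ : 0 < μ) (hαβ : α = (2 + 2 * μ) * β)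
    {z : GrushinSpace d k} (hz : z ≠ 0) :
    Tendsto (fun m : ℕ => regularizedWeightMul μ β n (1 / (m + 1 : ℝ)) u z) atTop
      (𝓝 (grho μ z ^ α * u z)) := by
  have hN := grushinGauge_pos hμ hz
  have h1 : Tendsto (fun m : ℕ => grushinGauge μ z + 1 / (m + 1 : ℝ)) atTop
      (𝓝 (grushinGauge μ z)) := by
    simpa using tendsto_one_div_add_atTop_nhds_zero_nat.const_add (grushinGauge μ z)
  have h2 := ((h1.rpow_const (p := β - n) (.inl hN.ne')).const_mul
    (grushinGauge μ z ^ n)).mul_const (u z)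
  have h3 : grho μ z ^ α = grushinGauge μ z ^ n * grushinGauge μ z ^ (β - n) := by
    rw [hαβ, grho_rpow hμ, ← Real.rpow_natCast, ← Real.rpow_add hN]
    congr 1
    ring
  rw [h3]
  exact h2

theorem ENNReal.lintegral_rpow_ofReal_add_le {Ω : Type*} [MeasurableSpace Ω] {ν : Measure Ω}
    {f g h : Ω → ℝ} {p c : ℝ} (hp : 1 ≤ p) (hc : 0 ≤ c) (hg : Measurable g)
    (hle : ∀ᵐ x ∂ν, f x ≤ g x + c * h x) :
    ∫⁻ x, ENNReal.ofReal (f x) ^ p ∂ν ≤ 2 ^ (p - 1) * (∫⁻ x, ENNReal.ofReal (g x) ^ p ∂ν +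
      ENNReal.ofReal c ^ p * ∫⁻ x, ENNReal.ofReal (h x) ^ p ∂ν) := by
  have hp0 : 0 ≤ p := by linarith
  rw [← lintegral_const_mul' _ _ (ENNReal.rpow_ne_top_of_nonneg hp0 ENNReal.ofReal_ne_top),
    ← lintegral_add_left (hg.ennreal_ofReal.pow_const p), ← lintegral_const_mul' _ _
      (ENNReal.rpow_ne_top_of_nonneg (by linarith) (by simp))]
  refine lintegral_mono_ae (hle.mono fun x hx => ?_)
  rw [← ENNReal.mul_rpow_of_nonneg _ _ hp0, ← ENNReal.ofReal_mul hc]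
  refine le_trans ?_ (ENNReal.rpow_add_le_mul_rpow_add_rpow _ _ hp)
  exact ENNReal.rpow_le_rpow ((ENNReal.ofReal_le_ofReal hx).trans ENNReal.ofReal_add_le) hp0

/-- The Sobolev inequality for the Grushin gradient with the weight `ρ^α`. -/
theorem exists_lintegral_grho_rpow_mul_le (hd : 1 ≤ d) (hμ : 0 < μ) {p Q : ℝ} (hp : 1 < p)
    (hQ : Q = d + (1 + μ) * k) (hpQ : p < Q) (hα : 0 < Q + p * (α - 1)) :
    ∃ C ≠ ∞, ∀ u : GrushinSpace d k → ℝ, ContDiff ℝ 1 u → HasCompactSupport u →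
      ∫⁻ z, ‖grho μ z ^ α * u z‖ₑ ^ (p * Q / (Q - p)) ≤
        C * (∫⁻ z, ENNReal.ofReal (grho μ z ^ α * gradMuSum μ u z) ^ p) ^ (Q / (Q - p)) := by
  have hQp : 0 < Q - p := by linarith
  have hQ0 : 0 < Q := by linarith
  have hp0 : 0 < p := by linarith
  have hE : 0 ≤ Q / (Q - p) := by positivity
  obtain ⟨C₁, hC₁, h₁⟩ := exists_lintegral_hardyWeight_le (d := d) (k := k) (α := α) hd hμ hp
    (hQ ▸ hα)
  obtain ⟨C₂, hC₂, h₂⟩ := exists_lintegral_rpow_le_gradMuSum (d := d) (k := k) hd hμ hp hQ hpQ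
  set β := α / (2 + 2 * μ) with hβ
  have hαβ : α = (2 + 2 * μ) * β := by rw [hβ]; field_simp
  obtain ⟨n, hn⟩ := exists_nat_ge (max 1 β)
  have hn1 : 1 ≤ n := by exact_mod_cast (le_max_left _ _).trans hn
  have hnβ : β ≤ n := (le_max_right _ _).trans hn
  have hc : 0 ≤ (2 * n - β) * (4 * (1 + μ)) := by
    have : (0 : ℝ) ≤ n := n.cast_nonneg
    exact mul_nonneg (by linarith) (by linarith)
  set c := (2 * n - β) * (4 * (1 + μ))
  set K : ℝ≥0∞ := 2 ^ (p - 1) * (1 + ENNReal.ofReal c ^ p * C₁) with hK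
  have hKtop : K ≠ ∞ := ENNReal.mul_ne_top (ENNReal.rpow_ne_top_of_nonneg (by linarith) (by simp))
    (ENNReal.add_ne_top.2 ⟨by simp, ENNReal.mul_ne_top
      (ENNReal.rpow_ne_top_of_nonneg hp0.le ENNReal.ofReal_ne_top) hC₁⟩)
  refine ⟨C₂ * K ^ (Q / (Q - p)), ENNReal.mul_ne_top hC₂ (ENNReal.rpow_ne_top_of_nonneg hE hKtop),
    fun u hu hcs => ?_⟩
  set D := ∫⁻ z, ENNReal.ofReal (grho μ z ^ α * gradMuSum μ u z) ^ p
  set v : ℕ → GrushinSpace d k → ℝ := fun m => regularizedWeightMul μ β n (1 / (m + 1 : ℝ)) u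
  have hv : ∀ m, ContDiff ℝ 1 (v m) := fun m =>
    contDiff_regularizedWeightMul hμ Nat.one_div_pos_of_nat hu
  have hmeas : Measurable fun z => grho μ z ^ α * gradMuSum μ u z :=
    ((continuous_grho hμ).measurable.pow_const α).mul (continuous_gradMuSum hμ hu).measurable
  have hbound : ∀ m, ∫⁻ z, ‖v m z‖ₑ ^ (p * Q / (Q - p)) ≤
      C₂ * K ^ (Q / (Q - p)) * D ^ (Q / (Q - p)) := fun m => by
    refine (h₂ (v m) (hv m) hcs.mul_left).trans ?_
    rw [mul_assoc, ← ENNReal.mul_rpow_of_nonneg _ _ hE]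
    gcongr
    refine (ENNReal.lintegral_rpow_ofReal_add_le hp.le hc hmeas
      ((ae_ne_zero hd).mono fun z hz => gradMuSum_regularizedWeightMul_le hμ
        Nat.one_div_pos_of_nat hn1 hnβ hαβ hu hz)).trans ?_
    rw [hK, mul_assoc, add_mul, one_mul, mul_assoc (ENNReal.ofReal c ^ p)]
    gcongr
    exact h₁ u hu hcs
  calc ∫⁻ z, ‖grho μ z ^ α * u z‖ₑ ^ (p * Q / (Q - p))
      = ∫⁻ z, liminf (fun m => ‖v m z‖ₑ ^ (p * Q / (Q - p))) atTop := by
        refine lintegral_congr_ae ((ae_ne_zero hd).mono fun z hz => ?_)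
        refine (Tendsto.liminf_eq ?_).symm
        exact ((tendsto_regularizedWeightMul hμ hαβ hz).enorm).ennrpow_const _
    _ ≤ liminf (fun m => ∫⁻ z, ‖v m z‖ₑ ^ (p * Q / (Q - p))) atTop :=
        lintegral_liminf_le fun m => (hv m).continuous.measurable.enorm.pow_const _
    _ ≤ _ := liminf_le_of_le (by isBoundedDefault) fun b hb => by
        obtain ⟨m, hm⟩ := hb.exists
        exact hm.trans (hbound m)

end weightedSobolev

section weightedHardySobolev

variable {d k : ℕ} {μ α : ℝ}

theorem hardySobolev_integrand_le {X R U p s Q : ℝ} (hX : 0 ≤ X) (hR : 0 < R) (hU : 0 ≤ U)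
    (hsp : s ≤ p) (hp : 0 < p) (hpQ : p < Q) :
    X ^ (μ * s) / R ^ (μ * s) * ((R ^ α * U) ^ (p * (Q - s) / (Q - p)) / R ^ s) ≤
      (X ^ μ * R ^ (α - (1 + μ)) * U) ^ s * (R ^ α * U) ^ (p * Q / (Q - p) * (1 - s / p)) := by
  have hQp : 0 < Q - p := by linarith
  have hQs : 0 < Q - s := by linarith
  rcases hU.eq_or_lt with rfl | hU
  · rw [mul_zero, Real.zero_rpow (by positivity)]
    simp only [zero_div, mul_zero]
    positivity
  have hexp : p * (Q - s) / (Q - p) = s + p * Q / (Q - p) * (1 - s / p) := by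
    field_simp
    ring
  rw [hexp, Real.rpow_add (by positivity), Real.mul_rpow (by positivity) hU.le,
    Real.mul_rpow (by positivity) (by positivity), Real.mul_rpow (by positivity) hU.le,
    Real.mul_rpow (by positivity) (by positivity), ← Real.rpow_mul hX, ← Real.rpow_mul hR.le α s,
    ← Real.rpow_mul hR.le _ s, show (α - (1 + μ)) * s = α * s - μ * s - s by ring, Real.rpow_sub hR, Real.rpow_sub hR]
  generalize (R ^ α) ^ (p * Q / (Q - p) * (1 - s / p)) = A
  generalize U ^ (p * Q / (Q - p) * (1 - s / p)) = B
  refine le_of_eq ?_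
  field_simp

/-- The weighted Hardy–Sobolev inequality for the Grushin gradient, for lower integrals. -/
theorem exists_lintegral_hardySobolev_le (hd : 1 ≤ d) (hμ : 0 < μ) {p s Q : ℝ} (hp : 1 < p)
    (hQ : Q = d + (1 + μ) * k) (hpQ : p < Q) (hs : 0 ≤ s) (hsp : s ≤ p)
    (hα : 0 < Q + p * (α - 1)) :
    ∃ C ≠ ∞, ∀ u : GrushinSpace d k → ℝ, ContDiff ℝ 1 u → HasCompactSupport u →
      ∫⁻ z, ENNReal.ofReal (‖z.1‖ ^ (μ * s) / grho μ z ^ (μ * s) *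
            (|grho μ z ^ α * u z| ^ (p * (Q - s) / (Q - p)) / grho μ z ^ s)) ≤
        C * (∫⁻ z, ENNReal.ofReal (grho μ z ^ α * gradMuSum μ u z) ^ p) ^
          ((Q - s) / (Q - p)) := by
  obtain ⟨C₁, hC₁, h₁⟩ := exists_lintegral_hardyWeight_le (d := d) (k := k) (α := α) hd hμ hp
    (hQ ▸ hα)
  obtain ⟨C₂, hC₂, h₂⟩ := exists_lintegral_grho_rpow_mul_le (d := d) (k := k) hd hμ hp hQ hpQ hα
  have hQp : 0 < Q - p := by linarith
  have hp0 : 0 < p := by linarith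
  have hQ0 : 0 < Q := by linarith
  have hθ0 : 0 ≤ s / p := by positivity
  have hθ1 : 0 ≤ 1 - s / p := by rw [sub_nonneg, div_le_one hp0]; exact hsp
  refine ⟨C₁ ^ (s / p) * C₂ ^ (1 - s / p), ENNReal.mul_ne_top
    (ENNReal.rpow_ne_top_of_nonneg hθ0 hC₁) (ENNReal.rpow_ne_top_of_nonneg hθ1 hC₂),
    fun u hu hc => ?_⟩
  set D := ∫⁻ z, ENNReal.ofReal (grho μ z ^ α * gradMuSum μ u z) ^ p
  have hm₁ : Measurable fun z => ENNReal.ofReal (hardyWeight μ α z * |u z|) ^ p :=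
    (((measurable_hardyWeight hμ).mul hu.continuous.abs.measurable).ennreal_ofReal).pow_const p
  have hm₂ : Measurable fun z => ‖grho μ z ^ α * u z‖ₑ ^ (p * Q / (Q - p)) :=
    ((((continuous_grho hμ).measurable.pow_const α).mul hu.continuous.measurable).enorm).pow_const _
  calc ∫⁻ z, ENNReal.ofReal (‖z.1‖ ^ (μ * s) / grho μ z ^ (μ * s) *
            (|grho μ z ^ α * u z| ^ (p * (Q - s) / (Q - p)) / grho μ z ^ s))
      ≤ ∫⁻ z, (ENNReal.ofReal (hardyWeight μ α z * |u z|) ^ p) ^ (s / p) *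
          (‖grho μ z ^ α * u z‖ₑ ^ (p * Q / (Q - p))) ^ (1 - s / p) := by
        refine lintegral_mono_ae ((ae_ne_zero hd).mono fun z hz => ?_)
        have hR := grho_pos hμ hz
        have hhw := hardyWeight_nonneg (μ := μ) (α := α) z
        rw [← ENNReal.rpow_mul, ← ENNReal.rpow_mul, mul_div_cancel₀ _ hp0.ne',
          Real.enorm_eq_ofReal_abs, abs_mul, abs_of_pos (Real.rpow_pos_of_pos hR α),
          ENNReal.ofReal_rpow_of_nonneg (by positivity) hs,
          ENNReal.ofReal_rpow_of_nonneg (by positivity) (by positivity),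
          ← ENNReal.ofReal_mul (by positivity)]
        exact ENNReal.ofReal_le_ofReal
          (hardySobolev_integrand_le (norm_nonneg _) hR (abs_nonneg _) hsp hp0 hpQ)
    _ ≤ (∫⁻ z, ENNReal.ofReal (hardyWeight μ α z * |u z|) ^ p) ^ (s / p) *
          (∫⁻ z, ‖grho μ z ^ α * u z‖ₑ ^ (p * Q / (Q - p))) ^ (1 - s / p) :=
        ENNReal.lintegral_mul_norm_pow_le hm₁.aemeasurable hm₂.aemeasurable hθ0 hθ1 (by ring)
    _ ≤ (C₁ * D) ^ (s / p) * (C₂ * D ^ (Q / (Q - p))) ^ (1 - s / p) := by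
        gcongr
        · exact h₁ u hu hc
        · exact h₂ u hu hc
    _ = _ := by
        rw [ENNReal.mul_rpow_of_nonneg _ _ hθ0, ENNReal.mul_rpow_of_nonneg _ _ hθ1,
          ← ENNReal.rpow_mul, show (Q - s) / (Q - p) = s / p + Q / (Q - p) * (1 - s / p) by
            field_simp
            ring, ENNReal.rpow_add_of_nonneg _ _ hθ0 (by positivity)]
        ring

theorem continuousAt_grho_rpow (hμ : 0 < μ) {z : GrushinSpace d k} (hz : z ≠ 0) (γ : ℝ) :
    ContinuousAt (fun z : GrushinSpace d k => grho μ z ^ γ) z :=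
  (continuous_grho hμ).continuousAt.rpow_const (.inl (grho_pos hμ hz).ne')

theorem setLIntegral_grho_rpow_ne_top (hd : 1 ≤ d) (hμ : 0 < μ) {γ : ℝ}
    (hγ : 0 < d + (1 + μ) * k + γ) {K : Set (GrushinSpace d k)} (hK : IsCompact K) :
    ∫⁻ z in K, ENNReal.ofReal (grho μ z ^ γ) ≠ ∞ := by
  obtain ⟨R, hR, hKR⟩ := hK.isBounded.subset_closedBall_lt 0 0
  obtain ⟨C, hC, h⟩ := exists_lintegral_weight_le_eulerDeriv (d := d) (k := k) hd hμ one_lt_two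
    (W := fun z => ENNReal.ofReal (grho μ z ^ γ))
    ((continuous_grho hμ).measurable.pow_const γ).ennreal_ofReal (m := γ)
    (fun t z => by
      rw [grho_dilation hμ (exp_pos t), Real.mul_rpow (exp_pos t).le (grho_nonneg z),
        ENNReal.ofReal_mul (by positivity), ← Real.exp_mul, mul_comm t]) hγ
  let φ : ContDiffBump (0 : GrushinSpace d k) := ⟨R, R + 1, hR, by linarith⟩
  have hφ : ContDiff ℝ 1 φ := φ.contDiff
  set f : GrushinSpace d k → ℝ := fun z => grho μ z ^ γ * |eulerDeriv μ φ z| ^ (2 : ℝ)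
  have hf : Continuous f := continuous_iff_continuousAt.2 fun z => by
    by_cases hz : z = 0
    · have : f =ᶠ[𝓝 z] fun _ => 0 := by
        rw [hz]
        filter_upwards [Metric.ball_mem_nhds (0 : GrushinSpace d k) hR] with w hw
        have h1 : φ =ᶠ[𝓝 w] fun _ => 1 := by
          filter_upwards [Metric.isOpen_ball.mem_nhds hw] with y hy
          exact φ.one_of_mem_closedBall (Metric.ball_subset_closedBall hy)
        have h2 : eulerDeriv μ φ w = 0 := by
          rw [eulerDeriv, h1.fderiv_eq]
          simp
        simp [f, h2]
      exact this.continuousAt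
    · exact (continuousAt_grho_rpow hμ hz γ).mul
        (((continuous_eulerDeriv hφ).abs.rpow_const fun _ => .inr zero_le_two).continuousAt)
  have hfc : HasCompactSupport f := by
    refine (φ.hasCompactSupport.fderiv (𝕜 := ℝ)).mono fun z hz h0 => hz ?_
    simp [f, eulerDeriv, h0]
  have hfin : ∫⁻ z, ENNReal.ofReal (grho μ z ^ γ) * ‖eulerDeriv μ φ z‖ₑ ^ (2 : ℝ) ≠ ∞ := by
    refine ne_of_eq_of_ne (lintegral_congr fun z => ?_)
      (hf.integrable_of_hasCompactSupport hfc).lintegral_lt_top.ne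
    rw [Real.enorm_eq_ofReal_abs, ENNReal.ofReal_rpow_of_nonneg (abs_nonneg _) zero_le_two,
      ← ENNReal.ofReal_mul (Real.rpow_nonneg (grho_nonneg z) _)]
  refine ne_top_of_le_ne_top (ENNReal.mul_ne_top hC hfin)
    (le_trans ?_ (h φ hφ φ.hasCompactSupport))
  refine (setLIntegral_mono_ae' hK.measurableSet ?_).trans (setLIntegral_le_lintegral K _)
  refine ae_of_all _ fun z hz => ?_
  rw [φ.one_of_mem_closedBall (hKR hz)]
  simp

theorem integrable_grho_rpow_mul_gradMuNorm_rpow (hd : 1 ≤ d) (hμ : 0 < μ) {p : ℝ} (hp : 0 < p)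
    (hα : 0 < d + (1 + μ) * k + α * p) {u : GrushinSpace d k → ℝ} (hu : ContDiff ℝ 1 u)
    (hc : HasCompactSupport u) :
    Integrable fun z => (grho μ z ^ α * gradMuNorm μ u z) ^ p := by
  have hcont := continuous_gradMuNorm hμ hu
  have hzero : ∀ z ∉ tsupport u, gradMuNorm μ u z = 0 := fun z hz => by
    have h0 : fderiv ℝ u z = 0 := by
      by_contra h
      exact hz (support_fderiv_subset ℝ h)
    rw [gradMuNorm_eq (hu.differentiable one_ne_zero z), h0]
    simp
  obtain ⟨M, hM⟩ := (hc.isCompact).exists_bound_of_continuousOn hcont.continuousOn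
  have hnn : ∀ z, 0 ≤ grho μ z ^ α * gradMuNorm μ u z := fun z =>
    mul_nonneg (Real.rpow_nonneg (grho_nonneg z) _) gradMuNorm_nonneg
  have hmeas : Measurable fun z => (grho μ z ^ α * gradMuNorm μ u z) ^ p :=
    (((continuous_grho hμ).measurable.pow_const α).mul hcont.measurable).pow_const p
  refine ⟨hmeas.aestronglyMeasurable, ?_⟩
  rw [hasFiniteIntegral_iff_ofReal (ae_of_all _ fun z => Real.rpow_nonneg (hnn z) _)]
  refine lt_of_le_of_lt ?_ (ENNReal.mul_lt_top (ENNReal.ofReal_lt_top (r := |M| ^ p))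
    (lt_top_iff_ne_top.2 (setLIntegral_grho_rpow_ne_top hd hμ hα hc.isCompact)))
  rw [← lintegral_const_mul' _ _ ENNReal.ofReal_ne_top,
    ← lintegral_indicator hc.isCompact.measurableSet]
  refine lintegral_mono fun z => ?_
  by_cases hz : z ∈ tsupport u
  · rw [indicator_of_mem hz, ← ENNReal.ofReal_mul (by positivity)]
    refine ENNReal.ofReal_le_ofReal ?_
    rw [Real.mul_rpow (Real.rpow_nonneg (grho_nonneg z) _) gradMuNorm_nonneg,
      ← Real.rpow_mul (grho_nonneg z), mul_comm]
    refine mul_le_mul_of_nonneg_right (Real.rpow_le_rpow gradMuNorm_nonneg ?_ hp.le)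
      (Real.rpow_nonneg (grho_nonneg z) _)
    exact (le_abs_self _).trans ((hM z hz).trans (le_abs_self M))
  · simp [hzero z hz, hp.ne']

theorem integral_le_of_lintegral_ofReal_le {Ω : Type*} [MeasurableSpace Ω] {ν : Measure Ω}
    {f : Ω → ℝ} {B : ℝ} (hB : 0 ≤ B) (h : ∫⁻ x, ENNReal.ofReal (f x) ∂ν ≤ ENNReal.ofReal B) :
    ∫ x, f x ∂ν ≤ B := by
  by_cases hf : Integrable f ν
  · rw [integral_eq_lintegral_pos_part_sub_lintegral_neg_part hf]
    exact (sub_le_self _ ENNReal.toReal_nonneg).trans (ENNReal.toReal_le_of_le_ofReal hB h)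
  · rwa [integral_undef hf]

end weightedHardySobolev

/-- Weighted Hardy–Sobolev inequality for the Grushin gradient. -/
theorem weighted_hardy_sobolev_grushin
    (d k : ℕ) (hd : 1 ≤ d) (hk : 1 ≤ k) (μ : ℝ) (hμ : 0 < μ)
    (Q : ℝ) (hQ : Q = d + (1 + μ) * k)
    (p s α : ℝ) (hp1 : 1 < p) (hpQ : p < Q) (hs0 : 0 ≤ s) (hsp : s ≤ p)
    (hα : (p - Q) / p < α) :
    ∃ C : ℝ, 0 < C ∧
      ∀ u : EuclideanSpace ℝ (Fin d) × EuclideanSpace ℝ (Fin k) → ℝ,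
        ContDiff ℝ (⊤ : ℕ∞) u → HasCompactSupport u →
        ∫ z, ‖z.1‖ ^ (μ * s) / grho μ z ^ (μ * s) *
            (|grho μ z ^ α * u z| ^ (p * (Q - s) / (Q - p)) / grho μ z ^ s)
          ≤ C * (∫ z, (grho μ z ^ α * gradMuNorm μ u z) ^ p) ^ ((Q - s) / (Q - p)) := by
  have hQp : 0 < Q - p := by linarith
  have hp0 : 0 < p := by linarith
  have hQα : 0 < Q + p * (α - 1) := by
    rw [div_lt_iff₀ hp0] at hα
    linarith
  have hE : 0 ≤ (Q - s) / (Q - p) := div_nonneg (by linarith) hQp.le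
  obtain ⟨C, hC, h⟩ := exists_lintegral_hardySobolev_le (d := d) (k := k) hd hμ hp1 hQ hpQ hs0 hsp
    hQα
  set C' := C * (2 ^ p) ^ ((Q - s) / (Q - p))
  have hC' : C' ≠ ∞ := ENNReal.mul_ne_top hC
    (ENNReal.rpow_ne_top_of_nonneg hE (ENNReal.rpow_ne_top_of_nonneg hp0.le (by simp)))
  refine ⟨C'.toReal + 1, by positivity, fun u hu' hc => ?_⟩
  have hu : ContDiff ℝ 1 u := hu'.of_le (by exact_mod_cast le_top)
  have hI := integrable_grho_rpow_mul_gradMuNorm_rpow (α := α) (p := p) hd hμ hp0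
    (by rw [← hQ]; rw [div_lt_iff₀ hp0] at hα; linarith) hu hc
  have hnn : ∀ z, 0 ≤ grho μ z ^ α * gradMuNorm μ u z := fun z =>
    mul_nonneg (Real.rpow_nonneg (grho_nonneg z) _) gradMuNorm_nonneg
  set D := ∫ z, (grho μ z ^ α * gradMuNorm μ u z) ^ p
  have hD0 : 0 ≤ D := integral_nonneg fun z => Real.rpow_nonneg (hnn z) _
  have hD : ∫⁻ z, ENNReal.ofReal (grho μ z ^ α * gradMuSum μ u z) ^ p ≤
      2 ^ p * ENNReal.ofReal D := by
    rw [ofReal_integral_eq_lintegral_ofReal hI (ae_of_all _ fun z => Real.rpow_nonneg (hnn z) _),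
      ← lintegral_const_mul' _ _ (ENNReal.rpow_ne_top_of_nonneg hp0.le (by simp))]
    refine lintegral_mono fun z => ?_
    rw [← ENNReal.ofReal_rpow_of_nonneg (hnn z) hp0.le, ← ENNReal.mul_rpow_of_nonneg _ _ hp0.le,
      ← ENNReal.ofReal_ofNat, ← ENNReal.ofReal_mul zero_le_two]
    refine ENNReal.rpow_le_rpow (ENNReal.ofReal_le_ofReal ?_) hp0.le
    have := mul_le_mul_of_nonneg_left
      (gradMuSum_le (μ := μ) (hu.differentiable one_ne_zero z))
      (Real.rpow_nonneg (grho_nonneg (μ := μ) z) α)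
    linarith
  have hlint : ∫⁻ z, ENNReal.ofReal (‖z.1‖ ^ (μ * s) / grho μ z ^ (μ * s) *
      (|grho μ z ^ α * u z| ^ (p * (Q - s) / (Q - p)) / grho μ z ^ s)) ≤
      ENNReal.ofReal (C'.toReal * D ^ ((Q - s) / (Q - p))) := by
    refine (h u hu hc).trans ?_
    rw [ENNReal.ofReal_mul ENNReal.toReal_nonneg, ENNReal.ofReal_toReal hC',
      ← ENNReal.ofReal_rpow_of_nonneg hD0 hE, mul_assoc, ← ENNReal.mul_rpow_of_nonneg _ _ hE]
    gcongr
  have hDE : 0 ≤ D ^ ((Q - s) / (Q - p)) := by positivity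
  calc ∫ z, ‖z.1‖ ^ (μ * s) / grho μ z ^ (μ * s) *
        (|grho μ z ^ α * u z| ^ (p * (Q - s) / (Q - p)) / grho μ z ^ s)
      ≤ C'.toReal * D ^ ((Q - s) / (Q - p)) := by
        refine integral_le_of_lintegral_ofReal_le ?_ hlint
        positivity
    _ ≤ _ := by linarith
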